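/- arXiv:2202.10428 — 2 statements merged into one kernel-verified Lean document; each statement's English description precedes it below -/
import Mathlib

section
/- Let A be a unital simple separable approximately divisible stably finite C*-algebra. Let (p_i)_{i≥1} and (q_i)_{i≥1} be sequences of projections in A with p_i p_j = 0 = q_i q_j for all i ≠ j, and with p_i Murray–von Neumann equivalent to q_i for every i. Set a = Σ_{i=1}^∞ 2^{−i} p_i and b = Σ_{i=1}^∞ 2^{−i} q_i (both series converge in norm). Then there is a norm-continuous map h : [0,1] → A such that h(0) = a, h(1) = b, h(t) is positive for every t ∈ [0,1], and h(t) is Cuntz equivalent to a for every t ∈ [0,1]. -/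
open Filter Topology

section Defs

variable {A : Type*}

/-- Cuntz subequivalence: `a ≾ b` iff there is a sequence `vₙ` with `‖vₙ * b * vₙ* - a‖ → 0`. -/
def CuntzLE [NonUnitalCStarAlgebra A] (a b : A) : Prop :=
  ∃ v : ℕ → A, Tendsto (fun n => ‖v n * b * star (v n) - a‖) atTop (𝓝 0)

/-- Cuntz equivalence: `a ∼ b` iff `a ≾ b` and `b ≾ a`. -/
def CuntzEquiv [NonUnitalCStarAlgebra A] (a b : A) : Prop :=
  CuntzLE a b ∧ CuntzLE b a

/-- A projection: a self-adjoint idempotent. -/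
def IsProjection [Mul A] [Star A] (p : A) : Prop :=
  IsSelfAdjoint p ∧ p * p = p

/-- Murray–von Neumann equivalence of projections. -/
def MvNEquiv [Mul A] [Star A] (p q : A) : Prop :=
  ∃ v : A, star v * v = p ∧ v * star v = q

/-- The hereditary subalgebra generated by a positive element `a`: the closure of `a A a`. -/
def her [NonUnitalCStarAlgebra A] (a : A) : Set A :=
  closure {x : A | ∃ y : A, x = a * y * a}

/-- A C*-algebra is simple if its only closed two-sided ideals are `⊥` and `⊤`. -/
def IsSimpleCStarAlgebra (A : Type*) [NonUnitalCStarAlgebra A] : Prop :=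
  ∀ I : TwoSidedIdeal A, IsClosed (I : Set A) → I = ⊥ ∨ I = ⊤

/-- A unital C*-algebra is approximately divisible if for each `N ≥ 1` there is an
approximately central sequence of unital `*`-homomorphisms `M_N(ℂ) ⊕ M_{N+1}(ℂ) → A`. -/
def ApproximatelyDivisible (A : Type*) [CStarAlgebra A] : Prop :=
  ∀ N : ℕ, 0 < N →
    ∃ φ : ℕ → (Matrix (Fin N) (Fin N) ℂ × Matrix (Fin (N + 1)) (Fin (N + 1)) ℂ) →⋆ₐ[ℂ] A,
      ∀ x c, Tendsto (fun n => ‖(φ n) x * c - c * (φ n) x‖) atTop (𝓝 (0 : ℝ))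

/-- Real rank zero: every self-adjoint element is a norm limit of self-adjoint elements
with finite spectrum. -/
def RealRankZero (A : Type*) [CStarAlgebra A] : Prop :=
  ∀ a : A, IsSelfAdjoint a → ∀ ε : ℝ, 0 < ε →
    ∃ b : A, IsSelfAdjoint b ∧ (spectrum ℂ b).Finite ∧ ‖a - b‖ < ε

/-- Stable finiteness: every isometry in every matrix algebra over `A` is a unitary. -/
def StablyFinite (A : Type*) [CStarAlgebra A] : Prop :=
  ∀ n : ℕ, ∀ v : Matrix (Fin n) (Fin n) A, star v * v = 1 → v * star v = 1

/-- A tracial state: a unital positive linear functional satisfying the trace identity. -/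
def IsTracialState [CStarAlgebra A] (φ : A →ₗ[ℂ] ℂ) : Prop :=
  φ 1 = 1 ∧ (∀ x : A, ∃ r : ℝ, 0 ≤ r ∧ φ (star x * x) = (r : ℂ)) ∧
    ∀ x y : A, φ (x * y) = φ (y * x)

/-- The dimension function associated to a tracial state:
`d_τ(a) = lim_{n → ∞} τ(a^{1/n})`. -/
noncomputable def dTau [CStarAlgebra A] (φ : A →ₗ[ℂ] ℂ) (a : A) : ℝ :=
  limUnder atTop (fun n : ℕ => (φ (cfc (fun t : ℝ => t ^ ((n : ℝ)⁻¹)) a)).re)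

/-- Strict comparison of positive elements with respect to tracial states. -/
def StrictComparison (A : Type*) [CStarAlgebra A] [PartialOrder A] [StarOrderedRing A] : Prop :=
  ∀ a b : A, 0 ≤ a → 0 ≤ b →
    (∀ φ : A →ₗ[ℂ] ℂ, IsTracialState φ → dTau φ a < dTau φ b) → CuntzLE a b

end Defs

section Paths
variable {A : Type*} [CStarAlgebra A]

/-- `w` is joined to `1` by a path of unitaries commuting with everything orthogonal to `e`. -/
def GoodPath (e w : A) : Prop :=
  ∃ γ : ℝ → A, Continuous γ ∧ γ 0 = 1 ∧ γ 1 = w ∧ (∀ t, γ t ∈ unitary A) ∧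
    ∀ t c, c * e = 0 → e * c = 0 → Commute c (γ t)

lemma GoodPath.one (e : A) : GoodPath e 1 :=
  ⟨fun _ => 1, continuous_const, rfl, rfl, fun _ => one_mem _, fun _ c _ _ => Commute.one_right c⟩

lemma GoodPath.mul {e w w' : A} (h : GoodPath e w) (h' : GoodPath e w') : GoodPath e (w * w') := by
  obtain ⟨γ, h1, h2, h3, h4, h5⟩ := h
  obtain ⟨γ', h1', h2', h3', h4', h5'⟩ := h'
  exact ⟨fun t => γ t * γ' t, h1.mul h1', by simp [h2, h2'], by simp [h3, h3'],
    fun t => mul_mem (h4 t) (h4' t),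
    fun t c hc hc' => (h5 t c hc hc').mul_right (h5' t c hc hc')⟩

lemma GoodPath.mem {e w : A} (h : GoodPath e w) : w ∈ unitary A := by
  obtain ⟨γ, h1, h2, h3, h4, h5⟩ := h
  exact h3 ▸ h4 1

lemma GoodPath.star {e w : A} (he : star e = e) (h : GoodPath e w) : GoodPath e (star w) := by
  obtain ⟨γ, h1, h2, h3, h4, h5⟩ := h
  refine ⟨fun t => Star.star (γ t), h1.star, by simp [h2], by simp [h3],
    fun t => Unitary.star_mem (h4 t), fun t c hc hc' => ?_⟩
  have := h5 t (Star.star c) (by rw [← star_star e, ← star_mul, he, hc', star_zero])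
    (by rw [← star_star e, ← star_mul, he, hc, star_zero])
  simpa using this.star_star

lemma exp_real_unitary {y : A} (hy : star y = -y) (t : ℝ) :
    NormedSpace.exp (t • y) ∈ unitary A := by
  let _ : NormedAlgebra ℚ A := NormedAlgebra.restrictScalars ℚ ℝ A
  apply NormedSpace.exp_mem_unitary_of_mem_skewAdjoint
  rw [skewAdjoint.mem_iff, star_smul, hy]; simp

lemma goodPath_exp' {e y : A} (hy : star y = -y)
    (hc : ∀ c, c * e = 0 → e * c = 0 → Commute c y) (s : ℝ) :
    GoodPath e (NormedSpace.exp (s • y)) := by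
  let _ : NormedAlgebra ℚ A := NormedAlgebra.restrictScalars ℚ ℝ A
  refine ⟨fun t => NormedSpace.exp ((t * s) • y), ?_, by simp, by simp,
    fun t => exp_real_unitary hy _, fun t c h h' => ?_⟩
  · exact NormedSpace.exp_continuous.comp (by fun_prop)
  · exact ((hc c h h').smul_right _).exp_right

lemma goodPath_exp {e y : A} (hy : star y = -y) (h : e * y = y) (h' : y * e = y) (s : ℝ) :
    GoodPath e (NormedSpace.exp (s • y)) := by
  refine goodPath_exp' hy (fun c hc hc' => ?_) s
  have h1 : c * y = 0 := by rw [← h, ← mul_assoc, hc, zero_mul]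
  have h2 : y * c = 0 := by rw [← h', mul_assoc, hc', mul_zero]
  rw [Commute, SemiconjBy, h1, h2]

lemma norm_unitary_le_one {u : A} (hu : u ∈ unitary A) : ‖u‖ ≤ 1 := by
  nontriviality A
  exact (CStarRing.norm_of_mem_unitary hu).le

lemma exp_rotation {y : A} (hy : star y = -y) :
    ‖NormedSpace.exp ((Real.pi / 2) • y) - (1 + y + y * y)‖ ≤ Real.pi * ‖y + y * y * y‖ := by
  let _ : NormedAlgebra ℚ A := NormedAlgebra.restrictScalars ℚ ℝ A
  set g : ℝ → A := fun t => NormedSpace.exp (t • (-y)) *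
    (1 + Real.sin t • y + (1 - Real.cos t) • (y * y)) with hg
  have hd : ∀ t : ℝ, HasDerivAt g (NormedSpace.exp (t • (-y)) *
      (-(1 - Real.cos t) • (y + y * y * y))) t := by
    intro t
    have h1 := hasDerivAt_exp_smul_const (𝕂 := ℝ) (-y) t
    have h2 : HasDerivAt (fun t : ℝ => 1 + Real.sin t • y + (1 - Real.cos t) • (y * y))
        (0 + Real.cos t • y + (0 - - Real.sin t) • (y * y)) t := by
      refine ((hasDerivAt_const _ _).add ((Real.hasDerivAt_sin t).smul_const y)).add
        (((hasDerivAt_const t (1:ℝ)).sub (Real.hasDerivAt_cos t)).smul_const _)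
    refine (h1.mul h2).congr_deriv ?_
    rw [mul_assoc, ← mul_add]
    congr 1
    simp only [mul_add, mul_sub, smul_sub, mul_smul_comm, neg_mul, mul_one, smul_add, smul_neg, zero_add, zero_sub,
      neg_neg, neg_smul, sub_smul, one_smul, mul_assoc]
    abel
  have hy' : star (-y) = -(-y) := by rw [star_neg, hy]
  have hb := norm_image_sub_le_of_norm_deriv_le_segment' (f := g) (a := 0) (b := Real.pi / 2)
    (C := ‖y + y * y * y‖ * 2)
    (fun x _ => (hd x).hasDerivWithinAt) (fun x hx => by
      refine (norm_mul_le _ _).trans ?_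
      rw [norm_smul]
      have h1 := norm_unitary_le_one (exp_real_unitary hy' x)
      have h2 : ‖-(1 - Real.cos x)‖ ≤ 2 := by
        rw [Real.norm_eq_abs, abs_le]
        have := Real.neg_one_le_cos x; have := Real.cos_le_one x
        constructor <;> linarith
      calc _ ≤ 1 * (2 * ‖y + y * y * y‖) := by gcongr
        _ = _ := by ring) (Real.pi / 2) ⟨by positivity, le_rfl⟩
  have hg0 : g 0 = 1 := by simp [hg]
  have hg1 : g (Real.pi / 2) = NormedSpace.exp (-((Real.pi / 2) • y)) * (1 + y + y * y) := by
    simp [hg]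
  have hE : NormedSpace.exp ((Real.pi / 2) • y) * NormedSpace.exp (-((Real.pi / 2) • y)) = 1 := by
    rw [← NormedSpace.exp_add_of_commute (Commute.neg_right (Commute.refl _)), add_neg_cancel,
      NormedSpace.exp_zero]
  have : NormedSpace.exp ((Real.pi / 2) • y) - (1 + y + y * y) =
      - (NormedSpace.exp ((Real.pi / 2) • y) * (g (Real.pi / 2) - g 0)) := by
    rw [hg0, hg1, mul_sub, ← mul_assoc, hE]; simp
  rw [this, norm_neg]
  refine (norm_mul_le _ _).trans ?_
  have h1 := norm_unitary_le_one (exp_real_unitary hy (Real.pi / 2))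
  calc _ ≤ 1 * (‖y + y * y * y‖ * 2 * (Real.pi / 2 - 0)) := by gcongr
    _ = _ := by ring

lemma goodPath_of_near {e u : A} (he : star e = e) (hu : u ∈ unitary A) (h2 : ‖u - 1‖ < 2)
    (hc : ∀ c, c * e = 0 → e * c = 0 → Commute c u) : GoodPath e u := by
  have h := expUnitary_argSelfAdjoint (u := ⟨u, hu⟩) h2
  set x := Unitary.argSelfAdjoint ⟨u, hu⟩ with hx
  have h' : NormedSpace.exp (Complex.I • (x : A)) = u := by
    have := congrArg (Subtype.val) h
    simpa [selfAdjoint.expUnitary_coe] using this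
  have := goodPath_exp' (e := e) (y := Complex.I • (x : A)) (by
    rw [star_smul, x.2.star_eq]; simp) (fun c h1 h2 => ?_) 1
  · simpa [h'] using this
  · apply Commute.smul_right
    rw [hx, Unitary.argSelfAdjoint_coe]
    symm
    refine Commute.cfc (hc c h1 h2).symm ?_ _
    have := hc (star c) (by rw [← star_star e, ← star_mul, he, h2, star_zero])
      (by rw [← star_star e, ← star_mul, he, h1, star_zero])
    simpa using this.symm.star_star
variable [PartialOrder A] [StarOrderedRing A]

lemma near_projections {e p q : A} (he : star e = e) (hp : IsProjection p)
    (hq : IsProjection q) (hpe : p * e = p) (hep : e * p = p) (hqe : q * e = q) (heq : e * q = q)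
    (hpq : ‖p - q‖ < 1 / 2) : ∃ w, GoodPath e w ∧ w * p * star w = q := by
  obtain ⟨hps, hpp⟩ := hp
  obtain ⟨hqs, hqq⟩ := hq
  rw [isSelfAdjoint_iff] at hps hqs
  set d := (p - q) * (p - q) with hd
  set z := q * p + (1 - q) * (1 - p) with hz
  have hds : star (p - q) = p - q := by rw [star_sub, hps, hqs]
  have hd0 : 0 ≤ d := by rw [hd]; nth_rw 1 [← hds]; exact star_mul_self_nonneg _
  have hdn : ‖d‖ < 1 := by
    calc ‖d‖ ≤ ‖p - q‖ * ‖p - q‖ := norm_mul_le _ _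
      _ < 1 := by nlinarith [norm_nonneg (p - q)]
  have hd1 : d ≤ 1 := (CStarAlgebra.norm_le_one_iff_of_nonneg d hd0).1 hdn.le
  have h1d : 0 ≤ 1 - d := sub_nonneg.2 hd1
  have hunit : IsUnit (1 - d) := isUnit_one_sub_of_norm_lt_one hdn
  have hzz : star z * z = 1 - d := by
    simp only [hz, hd, star_add, star_mul, star_sub, star_one, hps, hqs]
    have e1 : p * (q * (q * p)) = p * (q * p) := by rw [← mul_assoc q q, hqq]
    have e2 : (1 - p) * (1 - q) * ((1 - q) * (1 - p)) = (1 - p) * (1 - q) * (1 - p) := by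
      simp only [mul_sub, sub_mul, mul_one, one_mul, ← mul_assoc, hpp, hqq]
      simp only [mul_assoc, hpp, hqq]; abel
    simp only [add_mul, mul_add, mul_sub, sub_mul, mul_one, one_mul, mul_assoc, hpp, hqq]
    have a1 : ∀ x, p * (p * x) = p * x := fun x => by rw [← mul_assoc, hpp]
    have a2 : ∀ x, q * (q * x) = q * x := fun x => by rw [← mul_assoc, hqq]
    simp only [a1, a2, hpp, hqq]
    abel
  have hzz' : z * star z = 1 - d := by
    simp only [hz, hd, star_add, star_mul, star_sub, star_one, hps, hqs]
    have a1 : ∀ x, p * (p * x) = p * x := fun x => by rw [← mul_assoc, hpp]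
    have a2 : ∀ x, q * (q * x) = q * x := fun x => by rw [← mul_assoc, hqq]
    simp only [add_mul, mul_add, mul_sub, sub_mul, mul_one, one_mul, mul_assoc, hpp, hqq, a1, a2]
    abel
  have hzp : z * p = q * z := by
    simp only [hz, add_mul, mul_add, mul_sub, sub_mul, mul_one, one_mul, mul_assoc, hpp]
    have a2 : ∀ x, q * (q * x) = q * x := fun x => by rw [← mul_assoc, hqq]
    simp only [a2, hqq]
    abel
  have hs0 : 0 ≤ CFC.sqrt (1 - d) := CFC.sqrt_nonneg _
  have hss := CFC.sqrt_mul_sqrt_self (1 - d) h1d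
  have hs1 : CFC.sqrt (1 - d) ≤ 1 := by
    have := CFC.sqrt_le_sqrt (1 - d) 1 (by simpa using hd0)
    simpa using this
  have hsu : IsUnit (CFC.sqrt (1 - d)) := (CFC.isUnit_sqrt_iff _ h1d).2 hunit
  have hcomm : ∀ c, Commute c d → Commute c (CFC.sqrt (1 - d)) := by
    intro c hc
    rw [CFC.sqrt_eq_cfc]
    exact (((Commute.one_left c).sub_left hc.symm).cfc_nnreal _).symm
  obtain ⟨s, hs⟩ := hsu
  rw [← hs] at hs0 hs1 hss hcomm
  have hsstar : star (s : A) = s := (IsSelfAdjoint.of_nonneg hs0).star_eq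
  have hsinv : star ((s⁻¹ : Aˣ) : A) = ((s⁻¹ : Aˣ) : A) := by
    have : star s = s := Units.ext hsstar
    rw [← Units.coe_star, star_inv, this]
  have hzs : Commute z (s : A) := by
    apply hcomm
    have : Commute z (1 - d) := by
      rw [Commute, SemiconjBy]
      nth_rw 1 [← hzz]; rw [← hzz', mul_assoc]
    simpa using (Commute.one_right z).sub_right this
  have hps' : Commute p (s : A) := by
    apply hcomm
    rw [hd, Commute, SemiconjBy]
    have a1 : ∀ x, p * (p * x) = p * x := fun x => by rw [← mul_assoc, hpp]
    have a2 : ∀ x, q * (q * x) = q * x := fun x => by rw [← mul_assoc, hqq]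
    simp only [mul_sub, sub_mul, mul_assoc, hpp, hqq, a1, a2]
    abel
  set u : A := z * ((s⁻¹ : Aˣ) : A) with hu
  have huu : u ∈ unitary A := by
    rw [Unitary.mem_iff]
    constructor
    · rw [hu, star_mul, hsinv]
      calc _ = ((s⁻¹ : Aˣ) : A) * (star z * z) * ((s⁻¹ : Aˣ) : A) := by simp only [mul_assoc]
        _ = 1 := by rw [hzz, ← hss]; simp [mul_assoc]
    · rw [hu, star_mul, hsinv]
      have : z * ((s⁻¹ : Aˣ) : A) = ((s⁻¹ : Aˣ) : A) * z := hzs.units_inv_right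
      rw [this]
      have h3 : ((s⁻¹ : Aˣ) : A) * star z = star z * ((s⁻¹ : Aˣ) : A) := by
        have := congrArg star this
        simpa [star_mul, hsinv] using this
      rw [h3]
      calc _ = ((s⁻¹ : Aˣ) : A) * (z * star z) * ((s⁻¹ : Aˣ) : A) := by simp only [mul_assoc]
        _ = 1 := by rw [hzz', ← hss]; simp [mul_assoc]
  have hus : u * s = z := by simp [hu]
  have hz1 : ‖z - 1‖ ≤ ‖p - q‖ * 2 := by
    have h : z - 1 = q * (p - q) - (p - q) * p := by
      simp only [hz, mul_sub, sub_mul, mul_one, one_mul, hpp, hqq]; abel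
    have hpn : ‖p‖ ≤ 1 := by
      have : ‖p‖ * ‖p‖ = ‖p‖ := by
        rw [← CStarRing.norm_star_mul_self, hps, hpp]
      nlinarith [norm_nonneg p]
    have hqn : ‖q‖ ≤ 1 := by
      have : ‖q‖ * ‖q‖ = ‖q‖ := by
        rw [← CStarRing.norm_star_mul_self, hqs, hqq]
      nlinarith [norm_nonneg q]
    rw [h]
    calc _ ≤ ‖q * (p - q)‖ + ‖(p - q) * p‖ := norm_sub_le _ _
      _ ≤ ‖q‖ * ‖p - q‖ + ‖p - q‖ * ‖p‖ := add_le_add (norm_mul_le _ _) (norm_mul_le _ _)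
      _ ≤ 1 * ‖p - q‖ + ‖p - q‖ * 1 := by gcongr
      _ = _ := by ring
  have hu2 : ‖u - 1‖ < 2 := by
    have h : u - 1 = u * (1 - s) + (z - 1) := by rw [mul_sub, hus]; simp
    have h3 : ‖1 - (s : A)‖ ≤ 1 := by
      rw [CStarAlgebra.norm_le_one_iff_of_nonneg _ (sub_nonneg.2 hs1)]
      simpa using hs0
    rw [h]
    calc _ ≤ ‖u * (1 - s)‖ + ‖z - 1‖ := norm_add_le _ _
      _ ≤ ‖u‖ * ‖1 - (s : A)‖ + ‖z - 1‖ := by gcongr; exact norm_mul_le _ _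
      _ ≤ 1 * 1 + ‖p - q‖ * 2 := by gcongr; exact norm_unitary_le_one huu
      _ < 2 := by linarith
  refine ⟨u, goodPath_of_near he huu hu2 ?_, ?_⟩
  · intro c hc hc'
    have c1 : c * p = 0 := by rw [← hep, ← mul_assoc, hc, zero_mul]
    have c2 : p * c = 0 := by rw [← hpe, mul_assoc, hc', mul_zero]
    have c3 : c * q = 0 := by rw [← heq, ← mul_assoc, hc, zero_mul]
    have c4 : q * c = 0 := by rw [← hqe, mul_assoc, hc', mul_zero]
    have k1 : Commute c p := by rw [Commute, SemiconjBy, c1, c2]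
    have k2 : Commute c q := by rw [Commute, SemiconjBy, c3, c4]
    have k3 : Commute c z := by
      refine (k2.mul_right k1).add_right ?_
      exact ((Commute.one_right c).sub_right k2).mul_right ((Commute.one_right c).sub_right k1)
    have k4 : Commute c (s : A) := hcomm c ((k1.sub_right k2).mul_right (k1.sub_right k2))
    exact k3.mul_right k4.units_inv_right
  · have : u * p = q * u := by
      have h : ((s⁻¹ : Aˣ) : A) * p = p * ((s⁻¹ : Aˣ) : A) := (hps'.units_inv_right).symm
      rw [hu, mul_assoc, h, ← mul_assoc, hzp, mul_assoc]
    rw [this, mul_assoc, (Unitary.mem_iff.1 huu).2, mul_one]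

end Paths
section Simple
variable {A : Type*} [CStarAlgebra A] [PartialOrder A] [StarOrderedRing A]

lemma star_add_mul_add_le (x y : A) :
    star (x + y) * (x + y) ≤ 2 • (star x * x) + 2 • (star y * y) := by
  have h : 0 ≤ star (x - y) * (x - y) := star_mul_self_nonneg _
  rw [← sub_nonneg]
  convert h using 1
  simp only [star_add, star_sub, mul_add, add_mul, mul_sub, sub_mul]
  abel

/-- elements dominated by finitely many conjugates of `r`. -/
def DomSet (r : A) : Set A :=
  {y | ∃ (k : ℕ) (b : Fin k → A), star y * y ≤ ∑ i, star (b i) * r * b i}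

lemma domSet_smul {r : A} {y : A} {C : ℝ} (hC : 0 ≤ C) {k : ℕ} {b : Fin k → A}
    (h : star y * y ≤ C • ∑ i, star (b i) * r * b i) : y ∈ DomSet r := by
  refine ⟨k, fun i => Real.sqrt C • b i, h.trans_eq ?_⟩
  rw [Finset.smul_sum]
  refine Finset.sum_congr rfl fun i _ => ?_
  rw [star_smul, smul_mul_assoc, smul_mul_assoc, mul_smul_comm, smul_smul]
  simp [Real.mul_self_sqrt hC]

lemma domSet_add {r x y : A} (hx : x ∈ DomSet r) (hy : y ∈ DomSet r) : x + y ∈ DomSet r := by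
  obtain ⟨k, b, h⟩ := hx
  obtain ⟨l, c, h'⟩ := hy
  refine domSet_smul (C := 2) (by norm_num) (k := k + l) (b := Fin.append b c) ?_
  refine (star_add_mul_add_le x y).trans ?_
  rw [Fin.sum_univ_add]
  simp only [Fin.append_left, Fin.append_right, smul_add]
  have e1 : ∀ z : A, (2 : ℝ) • z = 2 • z := fun z => by rw [two_smul, two_smul]
  rw [e1, e1]
  exact add_le_add (nsmul_le_nsmul_right h 2) (nsmul_le_nsmul_right h' 2)

lemma domSet_mul_right {r x : A} (y : A) (hx : x ∈ DomSet r) : x * y ∈ DomSet r := by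
  obtain ⟨k, b, h⟩ := hx
  refine ⟨k, fun i => b i * y, ?_⟩
  have := star_left_conjugate_le_conjugate h y
  calc star (x * y) * (x * y) = star y * (star x * x) * y := by simp [star_mul, mul_assoc]
    _ ≤ _ := this
    _ = _ := by simp [Finset.mul_sum, Finset.sum_mul, star_mul, mul_assoc]

lemma domSet_mul_left {r x : A} (y : A) (hx : x ∈ DomSet r) : y * x ∈ DomSet r := by
  obtain ⟨k, b, h⟩ := hx
  refine domSet_smul (C := ‖y‖ ^ 2) (by positivity) (b := b) ?_
  have h1 : star y * y ≤ algebraMap ℝ A (‖y‖ ^ 2) := CStarAlgebra.star_mul_le_algebraMap_norm_sq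
  calc star (y * x) * (y * x) = star x * (star y * y) * x := by simp [star_mul, mul_assoc]
    _ ≤ star x * (algebraMap ℝ A (‖y‖ ^ 2)) * x := star_left_conjugate_le_conjugate h1 x
    _ = (‖y‖ ^ 2) • (star x * x) := by
      rw [Algebra.algebraMap_eq_smul_one]; simp
    _ ≤ _ := smul_le_smul_of_nonneg_left h (by positivity)

lemma full_of_simple (hsimple : IsSimpleCStarAlgebra A) {r : A} (hr : IsProjection r)
    (hr0 : r ≠ 0) : ∃ (k : ℕ) (x : Fin k → A), ∑ i, star (x i) * r * x i = 1 := by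
  have hrS : r ∈ DomSet r := ⟨1, fun _ => 1, by simp [hr.1.star_eq, hr.2]⟩
  have h0S : (0 : A) ∈ DomSet r := ⟨0, fun _ => 1, by simp⟩
  have hnegS : ∀ {x : A}, x ∈ DomSet r → -x ∈ DomSet r := fun {x} hx => by
    obtain ⟨k, b, h⟩ := hx
    exact ⟨k, b, by simpa using h⟩
  let I : TwoSidedIdeal A := TwoSidedIdeal.mk' (closure (DomSet r)) (subset_closure h0S)
    (fun {x y} hx hy => map_mem_closure₂ continuous_add hx hy fun a ha b hb => domSet_add ha hb)
    (fun {x} hx => map_mem_closure continuous_neg hx fun a ha => hnegS ha)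
    (fun {x y} hy => map_mem_closure (f := fun z => x * z) (by fun_prop) hy
      fun a ha => domSet_mul_left x ha)
    (fun {x y} hx => map_mem_closure (f := fun z => z * y) (by fun_prop) hx
      fun a ha => domSet_mul_right y ha)
  have hI : (I : Set A) = closure (DomSet r) := TwoSidedIdeal.coe_mk' ..
  have hIc : IsClosed (I : Set A) := by rw [hI]; exact isClosed_closure
  have hrI : r ∈ I := by rw [← SetLike.mem_coe, hI]; exact subset_closure hrS
  have h1 : (1 : A) ∈ closure (DomSet r) := by
    rcases hsimple I hIc with h | h
    · rw [h, TwoSidedIdeal.mem_bot] at hrI; exact absurd hrI hr0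
    · rw [← hI, h]; trivial
  obtain ⟨y, hy, hy1⟩ := Metric.mem_closure_iff.1 h1 1 one_pos
  rw [dist_eq_norm] at hy1
  have hyu : IsUnit y := by
    have := isUnit_one_sub_of_norm_lt_one hy1
    simpa using this
  obtain ⟨u, rfl⟩ := hyu
  have h1S : (1 : A) ∈ DomSet r := by simpa using domSet_mul_left ((u⁻¹ : Aˣ) : A) hy
  obtain ⟨k, b, hb⟩ := h1S
  set m := ∑ i, star (b i) * r * b i with hm
  have hm1 : 1 ≤ m := by simpa using hb
  have hm0 : IsStrictlyPositive m := IsStrictlyPositive.of_le isStrictlyPositive_one hm1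
  have hmn : 0 ≤ m := hm0.nonneg
  have hsu : IsUnit (CFC.sqrt m) := (CFC.isUnit_sqrt_iff _ hmn).2 hm0.isUnit
  have hss := CFC.sqrt_mul_sqrt_self m hmn
  have hs0 : 0 ≤ CFC.sqrt m := CFC.sqrt_nonneg _
  obtain ⟨s, hs⟩ := hsu
  rw [← hs] at hs0 hss
  have hsinv : star ((s⁻¹ : Aˣ) : A) = ((s⁻¹ : Aˣ) : A) := by
    have : star s = s := Units.ext (IsSelfAdjoint.of_nonneg hs0).star_eq
    rw [← Units.coe_star, star_inv, this]
  refine ⟨k, fun i => b i * ((s⁻¹ : Aˣ) : A), ?_⟩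
  calc _ = ((s⁻¹ : Aˣ) : A) * m * ((s⁻¹ : Aˣ) : A) := by
        simp [hm, Finset.mul_sum, Finset.sum_mul, star_mul, mul_assoc, hsinv]
    _ = 1 := by rw [← hss]; simp

lemma full_pad {r : A} {k : ℕ} {x : Fin k → A} (h : ∑ i, star (x i) * r * x i = 1) (l : ℕ) :
    ∃ x' : Fin (k + l) → A, ∑ i, star (x' i) * r * x' i = 1 := by
  refine ⟨Fin.append x (fun _ => 0), ?_⟩
  rw [Fin.sum_univ_add]; simp [h]

end Simple
section Seq

lemma rot_cube {R : Type*} [Ring R] {X X' : R} (h1 : X * X = 0) (h2 : X' * X' = 0)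
    (h3 : X * X' * X = X) (h4 : X' * X * X' = X') :
    (X - X') + (X - X') * (X - X') * (X - X') = 0 := by
  simp only [mul_sub, sub_mul, h1, h2, h3, h4, zero_mul, zero_sub, sub_zero]
  simp only [neg_mul, mul_assoc, h1, h2, mul_zero]
  simp only [← mul_assoc, h3, h4]
  abel

lemma rot_conj {R : Type*} [Ring R] {X X' T : R} (h1 : X * X = 0) (h2 : X' * X' = 0)
    (h3 : X * X' * X = X) (h4 : X' * X * X' = X') (t1 : T * X = 0) (t2 : X * T = 0)
    (t3 : T * X' = 0) (t4 : X' * T = 0) :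
    (1 + (X - X') + (X - X') * (X - X')) * (T + X' * X) *
      (1 - (X - X') + (X - X') * (X - X')) = T + X * X' := by
  have a1 : (1 + (X - X') + (X - X') * (X - X')) * (T + X' * X) = T + X := by
    simp only [mul_add, add_mul, mul_sub, sub_mul, one_mul, mul_assoc, t2, t4, h1, mul_zero]
    simp only [← mul_assoc, h2, h3, h4, zero_mul]
    simp
  rw [a1]
  simp only [mul_add, add_mul, mul_sub, sub_mul, mul_one]
  simp only [← mul_assoc, t1, t3, h1, h3, zero_mul]
  rw [mul_assoc X X' X', h2]
  simp
  abel

variable (A : Type*) [CStarAlgebra A]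

/-- bounded sequences -/
abbrev BSeq := BoundedContinuousFunction ℕ A

/-- the ideal of null sequences -/
noncomputable def nullIdeal : TwoSidedIdeal (BSeq A) :=
  TwoSidedIdeal.mk' {x : BSeq A | Tendsto (fun n => x n) atTop (𝓝 0)} (by simp)
    (fun {x y} hx hy => by simpa using Tendsto.add hx hy)
    (fun {x} hx => by simpa using Tendsto.neg hx)
    (fun {x y} hy => by
      refine squeeze_zero_norm (a := fun n => ‖x‖ * ‖y n‖) (fun n => ?_) ?_
      · exact (norm_mul_le (x n) (y n)).trans (by gcongr; exact x.norm_coe_le_norm n)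
      · simpa using (tendsto_norm_zero.comp hy).const_mul ‖x‖)
    (fun {x y} hx => by
      refine squeeze_zero_norm (a := fun n => ‖x n‖ * ‖y‖) (fun n => ?_) ?_
      · exact (norm_mul_le (x n) (y n)).trans (by gcongr; exact y.norm_coe_le_norm n)
      · simpa using (tendsto_norm_zero.comp hx).mul_const ‖y‖)

/-- the sequence algebra (as a ring) -/
def SeqQ := (nullIdeal A).ringCon.Quotient

noncomputable instance : Ring (SeqQ A) :=
  inferInstanceAs (Ring (nullIdeal A).ringCon.Quotient)

variable {A}

/-- quotient map -/
noncomputable def mkQ : BSeq A →+* SeqQ A := (nullIdeal A).ringCon.mk'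

lemma mkQ_eq {x y : BSeq A} : mkQ x = mkQ y ↔ Tendsto (fun n => x n - y n) atTop (𝓝 0) := by
  have h1 : mkQ x = mkQ y ↔ (nullIdeal A).ringCon x y := RingCon.eq _
  rw [h1, TwoSidedIdeal.rel_iff]
  exact TwoSidedIdeal.mem_mk' _ _ _ _ _ _ _

/-- constant sequences -/
noncomputable def cst : A →+* SeqQ A :=
  mkQ.comp
    { toFun := fun a => BoundedContinuousFunction.const ℕ a
      map_one' := rfl
      map_mul' := fun _ _ => rfl
      map_zero' := rfl
      map_add' := fun _ _ => rfl }

lemma cst_apply (a : A) : cst a = mkQ (BoundedContinuousFunction.const ℕ a) := rfl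

/-- the second element is the adjoint of the first one -/
def Adj (x x' : SeqQ A) : Prop := ∃ X : BSeq A, mkQ X = x ∧ mkQ (star X) = x'

lemma mkQ_star {x y : BSeq A} (h : mkQ x = mkQ y) : mkQ (star x) = mkQ (star y) := by
  rw [mkQ_eq] at h ⊢
  simpa using h.star

lemma Adj.cst (a : A) : Adj (cst a) (cst (star a)) := ⟨_, rfl, rfl⟩

lemma Adj.symm {x x' : SeqQ A} (h : Adj x x') : Adj x' x := by
  obtain ⟨X, h1, h2⟩ := h
  exact ⟨star X, h2, by rw [star_star]; exact h1⟩

lemma Adj.mul {x x' y y' : SeqQ A} (h : Adj x x') (h' : Adj y y') : Adj (x * y) (y' * x') := by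
  obtain ⟨X, rfl, rfl⟩ := h
  obtain ⟨Y, rfl, rfl⟩ := h'
  exact ⟨X * Y, map_mul _ _ _, by rw [star_mul, map_mul]⟩

lemma Adj.add {x x' y y' : SeqQ A} (h : Adj x x') (h' : Adj y y') : Adj (x + y) (x' + y') := by
  obtain ⟨X, rfl, rfl⟩ := h
  obtain ⟨Y, rfl, rfl⟩ := h'
  exact ⟨X + Y, map_add _ _ _, by rw [star_add, map_add]⟩

lemma Adj.sum {ι : Type*} (s : Finset ι) {x x' : ι → SeqQ A} (h : ∀ i, Adj (x i) (x' i)) :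
    Adj (∑ i ∈ s, x i) (∑ i ∈ s, x' i) := by
  choose X h1 h2 using h
  exact ⟨∑ i ∈ s, X i, by rw [map_sum]; simp [h1], by rw [star_sum, map_sum]; simp [h2]⟩

/-- reachability by good unitaries -/
def Reach (e : A) (P P' : SeqQ A) : Prop :=
  ∃ w : BSeq A, (∀ n, GoodPath e (w n)) ∧ mkQ w * P * mkQ (star w) = P'

lemma Reach.refl (e : A) (P : SeqQ A) : Reach e P P :=
  ⟨1, fun _ => GoodPath.one e, by simp⟩

lemma Reach.trans {e : A} {P P' P'' : SeqQ A} (h : Reach e P P') (h' : Reach e P' P'') :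
    Reach e P P'' := by
  obtain ⟨w, hw, rfl⟩ := h
  obtain ⟨w', hw', rfl⟩ := h'
  exact ⟨w' * w, fun n => (hw' n).mul (hw n), by rw [star_mul, map_mul, map_mul]; simp only [mul_assoc]⟩

lemma Reach.symm {e : A} (he : star e = e) {P P' : SeqQ A} (h : Reach e P P') :
    Reach e P' P := by
  obtain ⟨w, hw, rfl⟩ := h
  have h1 : mkQ (star w) * mkQ w = 1 := by
    rw [← map_mul]
    have : star w * w = 1 := by
      ext n; exact (Unitary.mem_iff.1 (hw n).mem).1
    rw [this, map_one]
  refine ⟨star w, fun n => (hw n).star he, ?_⟩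
  rw [star_star]
  calc _ = (mkQ (star w) * mkQ w) * P * (mkQ (star w) * mkQ w) := by simp only [mul_assoc]
    _ = P := by rw [h1]; simp

lemma reach_rot {e : A} (he : star e = e) (hee : e * e = e) {x x' T : SeqQ A} (hx : Adj x x')
    (h1 : x * x = 0) (h2 : x' * x' = 0) (h3 : x * x' * x = x) (h4 : x' * x * x' = x')
    (e1 : cst e * x = x) (e2 : x * cst e = x) (e3 : cst e * x' = x') (e4 : x' * cst e = x')
    (t1 : T * x = 0) (t2 : x * T = 0) (t3 : T * x' = 0) (t4 : x' * T = 0) :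
    Reach e (T + x' * x) (T + x * x') := by
  obtain ⟨X, hX, hX'⟩ := hx
  set E : BSeq A := BoundedContinuousFunction.const ℕ e with hE
  set Y : BSeq A := E * (X - star X) * E with hY
  have hYn : ∀ n, Y n = e * (X n - star (X n)) * e := fun n => rfl
  have hYm : mkQ Y = x - x' := by
    rw [hY, map_mul, map_mul, map_sub, hX, hX', hE, ← cst_apply, mul_sub, sub_mul, e1, e2, e3, e4]
  have hYs : ∀ n, star (Y n) = - Y n := fun n => by
    rw [hYn]; simp only [star_mul, star_sub, star_star, he, mul_sub, sub_mul, neg_sub, mul_assoc]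
  have hYs' : star Y = -Y := by ext n; exact hYs n
  clear_value Y
  let w : BSeq A := BoundedContinuousFunction.ofNormedAddCommGroupDiscrete
    (fun n => NormedSpace.exp ((Real.pi / 2) • Y n)) 1
    (fun n => norm_unitary_le_one (exp_real_unitary (hYs n) _))
  have hw : mkQ w = 1 + (x - x') + (x - x') * (x - x') := by
    rw [← hYm, ← map_mul, ← map_one mkQ, ← map_add, ← map_add, mkQ_eq]
    have hc : Tendsto (fun n => (Y + Y * Y * Y) n - (0 : BSeq A) n) atTop (𝓝 0) := by
      rw [← mkQ_eq, map_add, map_mul, map_mul, hYm, rot_cube h1 h2 h3 h4, map_zero]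
    refine squeeze_zero_norm (a := fun n => Real.pi * ‖(Y + Y * Y * Y) n - (0 : BSeq A) n‖)
      (fun n => ?_) ?_
    · have := exp_rotation (hYs n)
      simpa [w] using this
    · simpa using (tendsto_norm_zero.comp hc).const_mul Real.pi
  refine ⟨w, fun n => ?_, ?_⟩
  · refine goodPath_exp (hYs n) ?_ ?_ _
    · rw [hYn]; simp only [← mul_assoc, hee]
    · rw [hYn]; simp only [mul_assoc, hee]
  · have hw' : mkQ (star w) = 1 - (x - x') + (x - x') * (x - x') := by
      have h : mkQ w = mkQ (1 + Y + Y * Y) := by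
        rw [hw, map_add, map_add, map_mul, map_one, hYm]
      rw [mkQ_star h, star_add, star_add, star_mul, star_one, hYs', neg_mul_neg, map_add, map_add,
        map_mul, map_one, map_neg, hYm, ← sub_eq_add_neg]
    rw [hw, hw', rot_conj h1 h2 h3 h4 t1 t2 t3 t4]

end Seq
section Coord
variable {A : Type*} [CStarAlgebra A]

lemma pi_right {p v : A} (hp : IsProjection p) (h : star v * v = p) : v * p = v := by
  have : star (v - v * p) * (v - v * p) = 0 := by
    simp only [star_sub, star_mul, hp.1.star_eq, mul_sub, sub_mul, h, hp.2]
    simp only [← mul_assoc, h, hp.2]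
    simp only [mul_assoc, h, hp.2]
    simp
  rw [CStarRing.star_mul_self_eq_zero_iff] at this
  exact (sub_eq_zero.1 this).symm

lemma reach_coord {e p q v : A} (he : IsProjection e) (hp : IsProjection p)
    (hpe : p * e = p) (hep : e * p = p) (hqe : q * e = q)
    (heq : e * q = q) (hv : star v * v = p) (hv' : v * star v = q) (hvp : v * p = v)
    (hqv : q * v = v)
    {k : ℕ} {x : Fin k → A} (hx : ∑ i, star (x i) * (e - p) * x i = 1)
    {g T : SeqQ A} {c c' : Fin k → SeqQ A} (hadj : ∀ i, Adj (c i) (c' i))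
    (kg : ∀ a, g * cst a = cst a * g) (kc : ∀ a i, c i * cst a = cst a * c i)
    (kc' : ∀ a i, c' i * cst a = cst a * c' i)
    (hcg : ∀ i, c i * g = c i) (hgc : ∀ i, g * c i = 0) (hcg' : ∀ i, c' i * g = 0)
    (hgc' : ∀ i, g * c' i = c' i) (hcc : ∀ i, c' i * c i = g)
    (hcc0 : ∀ i m, i ≠ m → c' i * c m = 0)
    (hTg : T * g = 0) (hgT : g * T = 0) (hTc : ∀ i, T * c i = cst p * c i)
    (hTc' : ∀ i, c' i * T = c' i * cst p) :
    Reach e (T + cst p * g) (T + cst q * g) := by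
  obtain ⟨hes, hee⟩ := he
  obtain ⟨hps, hpp⟩ := hp
  rw [isSelfAdjoint_iff] at hes hps
  set r := e - p with hr
  have hrr : r * r = r := by simp [hr, mul_sub, sub_mul, hee, hpe, hep, hpp]
  have hrs : star r = r := by simp [hr, hes, hps]
  have hrp : r * p = 0 := by simp [hr, sub_mul, hep, hpp]
  have hpr : p * r = 0 := by simp [hr, mul_sub, hpe, hpp]
  have her : e * r = r := by simp [hr, mul_sub, hee, hep]
  have hre : r * e = r := by simp [hr, sub_mul, hee, hpe]
  set X : SeqQ A := ∑ i, cst (r * x i * p) * c i with hX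
  set X' : SeqQ A := ∑ i, cst (p * star (x i) * r) * c' i with hX'
  have hA : Adj X X' := by
    refine Adj.sum _ fun i => ?_
    have h := (Adj.cst (r * x i * p)).mul (hadj i)
    rw [kc'] at h
    simpa [star_mul, hrs, hps, mul_assoc] using h
  have Xg : X * g = X := by
    rw [hX, Finset.sum_mul]; refine Finset.sum_congr rfl fun i _ => ?_
    rw [mul_assoc, hcg]
  have gX : g * X = 0 := by
    rw [hX, Finset.mul_sum]; refine Finset.sum_eq_zero fun i _ => ?_
    rw [← mul_assoc, kg, mul_assoc, hgc, mul_zero]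
  have Xg' : X' * g = 0 := by
    rw [hX', Finset.sum_mul]; refine Finset.sum_eq_zero fun i _ => ?_
    rw [mul_assoc, hcg', mul_zero]
  have gX' : g * X' = X' := by
    rw [hX', Finset.mul_sum]; refine Finset.sum_congr rfl fun i _ => ?_
    rw [← mul_assoc, kg, mul_assoc, hgc']
  have Xp : X * cst p = X := by
    rw [hX, Finset.sum_mul]; refine Finset.sum_congr rfl fun i _ => ?_
    rw [mul_assoc, kc, ← mul_assoc, ← map_mul, mul_assoc (r * x i), hpp]
  have pX' : cst p * X' = X' := by
    rw [hX', Finset.mul_sum]; refine Finset.sum_congr rfl fun i _ => ?_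
    rw [← mul_assoc, ← map_mul]; simp only [← mul_assoc, hpp]
  have eX : cst e * X = X := by
    rw [hX, Finset.mul_sum]; refine Finset.sum_congr rfl fun i _ => ?_
    rw [← mul_assoc, ← map_mul]; simp only [← mul_assoc, her]
  have Xe : X * cst e = X := by
    rw [← Xp, mul_assoc, ← map_mul, hpe]
  have eX' : cst e * X' = X' := by
    rw [← pX', ← mul_assoc, ← map_mul, hep]
  have Xe' : X' * cst e = X' := by
    rw [hX', Finset.sum_mul]; refine Finset.sum_congr rfl fun i _ => ?_
    rw [mul_assoc, kc', ← mul_assoc, ← map_mul, mul_assoc (p * star (x i)), hre]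
  have XX' : X' * X = cst p * g := by
    have h1 : ∀ i, cst (p * star (x i) * r) * c' i * X =
        cst (p * (star (x i) * r * x i) * p) * g := by
      intro i
      rw [hX, Finset.mul_sum, Finset.sum_eq_single i]
      · calc _ = cst (p * star (x i) * r) * (c' i * cst (r * x i * p)) * c i := by
              simp only [mul_assoc]
          _ = (cst (p * star (x i) * r) * cst (r * x i * p)) * (c' i * c i) := by
              rw [kc']; simp only [mul_assoc]
          _ = _ := by
            rw [← map_mul, hcc]
            congr 2
            calc _ = p * star (x i) * (r * r) * x i * p := by simp only [mul_assoc]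
              _ = _ := by rw [hrr]; simp only [mul_assoc]
      · intro m _ hm
        calc _ = cst (p * star (x i) * r) * (c' i * cst (r * x m * p)) * c m := by
              simp only [mul_assoc]
          _ = (cst (p * star (x i) * r) * cst (r * x m * p)) * (c' i * c m) := by
              rw [kc']; simp only [mul_assoc]
          _ = 0 := by rw [hcc0 i m hm.symm, mul_zero]
      · simp
    nth_rw 1 [hX']
    rw [Finset.sum_mul, Finset.sum_congr rfl fun i _ => h1 i, ← Finset.sum_mul, ← map_sum,
      ← Finset.sum_mul, ← Finset.mul_sum, hx, mul_one, hpp]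
  have TX : T * X = 0 := by
    rw [hX, Finset.mul_sum]; refine Finset.sum_eq_zero fun i _ => ?_
    rw [← kc, ← mul_assoc, hTc, mul_assoc, kc, ← mul_assoc, ← map_mul]
    simp only [← mul_assoc, hpr]; simp
  have XT : X * T = 0 := by rw [← Xg, mul_assoc, hgT, mul_zero]
  have TX' : T * X' = 0 := by rw [← gX', ← mul_assoc, hTg, zero_mul]
  have XT' : X' * T = 0 := by
    rw [hX', Finset.sum_mul]; refine Finset.sum_eq_zero fun i _ => ?_
    rw [mul_assoc, hTc', kc', ← mul_assoc, ← map_mul, mul_assoc _ r p, hrp]; simp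
  have XX : X * X = 0 := by nth_rw 1 [← Xg]; rw [mul_assoc, gX, mul_zero]
  have XXb : X' * X' = 0 := by nth_rw 2 [← gX']; rw [← mul_assoc, Xg', zero_mul]
  have c3 : X * X' * X = X := by rw [mul_assoc, XX', ← mul_assoc, Xp, Xg]
  have c4 : X' * X * X' = X' := by rw [XX', mul_assoc, gX', pX']
  clear_value X X'
  have s1 := reach_rot hes hee hA XX XXb c3 c4 eX Xe eX' Xe' TX XT TX' XT'
  rw [XX'] at s1
  have hev : e * v = v := by rw [← hqv, ← mul_assoc, heq]
  have hve : v * e = v := by rw [← hvp, mul_assoc, hpe]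
  have hvs : star v * q = star v := by rw [← hv', ← mul_assoc, hv, ← hps, ← star_mul, hvp]
  have hves : star v * e = star v := by rw [← hes, ← star_mul, hev]
  have s2 := reach_rot (e := e) (T := T) (x := cst v * X') (x' := X * cst (star v)) hes hee
    ((Adj.cst v).mul hA.symm)
    (by
      calc _ = cst v * (X' * cst v * X') := by simp only [mul_assoc]
        _ = cst v * (X' * (cst v * g) * X') := by
          nth_rw 2 [← gX']; simp only [mul_assoc]
        _ = cst v * (X' * g) * (cst v * X') := by rw [← kg]; simp only [mul_assoc]
        _ = 0 := by rw [Xg']; simp)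
    (by
      calc _ = (X * cst (star v) * X) * cst (star v) := by simp only [mul_assoc]
        _ = (X * (g * cst (star v)) * X) * cst (star v) := by
          nth_rw 1 [← Xg]; simp only [mul_assoc]
        _ = X * cst (star v) * (g * X) * cst (star v) := by rw [kg]; simp only [mul_assoc]
        _ = 0 := by rw [gX]; simp)
    (by
      calc _ = cst v * (X' * X) * (cst (star v) * cst v) * X' := by simp only [mul_assoc]
        _ = cst v * (X' * X * (cst p * X')) := by rw [← map_mul, hv]; simp only [mul_assoc]
        _ = _ := by rw [pX', c4])
    (by
      calc _ = X * (cst (star v) * cst v) * X' * X * cst (star v) := by simp only [mul_assoc]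
        _ = X * cst (star v) := by rw [← map_mul, hv, Xp, c3])
    (by rw [← mul_assoc, ← map_mul, hev]) (by rw [mul_assoc, Xe'])
    (by rw [← mul_assoc, eX]) (by rw [mul_assoc, ← map_mul, hves])
    (by
      calc T * (cst v * X') = T * (cst v * g) * X' := by nth_rw 1 [← gX']; simp only [mul_assoc]
        _ = 0 := by rw [← kg, ← mul_assoc, hTg]; simp)
    (by rw [mul_assoc, XT', mul_zero]) (by rw [← mul_assoc, TX, zero_mul])
    (by
      calc X * cst (star v) * T = X * (g * cst (star v)) * T := by
            nth_rw 1 [← Xg]; simp only [mul_assoc]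
        _ = 0 := by rw [kg]; simp only [mul_assoc, hgT, mul_zero])
  have f1 : X * cst (star v) * (cst v * X') = X * X' := by
    calc _ = X * (cst (star v) * cst v) * X' := by simp only [mul_assoc]
      _ = _ := by rw [← map_mul, hv, Xp]
  have f2 : cst v * X' * (X * cst (star v)) = cst q * g := by
    calc _ = cst v * (X' * X) * cst (star v) := by simp only [mul_assoc]
      _ = cst v * cst p * (g * cst (star v)) := by rw [XX']; simp only [mul_assoc]
      _ = _ := by rw [kg, ← mul_assoc, ← map_mul, ← map_mul, hvp, hv']
  rw [f1, f2] at s2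
  exact s1.trans s2

end Coord
section Units
variable {A : Type*} [CStarAlgebra A]

lemma exists_helpers {J : Type*} [DecidableEq J] {s : Finset J} {k : ℕ} (h : k ≤ s.card) :
    ∃ l : Fin k → J, Function.Injective l ∧ ∀ i, l i ∈ s :=
  ⟨fun i => (s.equivFin.symm (Fin.castLE h i) : J),
    fun i m him => by
      have := s.equivFin.symm.injective (Subtype.ext him)
      exact Fin.castLE_injective h this,
    fun i => (s.equivFin.symm (Fin.castLE h i)).2⟩

lemma reach_all {e p q v : A} (he : IsProjection e) (hp : IsProjection p) (hq : IsProjection q)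
    (hpe : p * e = p) (hep : e * p = p) (hqe : q * e = q)
    (heq : e * q = q) (hv : star v * v = p) (hv' : v * star v = q)
    {k : ℕ} {x y : Fin k → A} (hx : ∑ i, star (x i) * (e - p) * x i = 1)
    (hy : ∑ i, star (y i) * (e - q) * y i = 1)
    {J β : Type*} [Fintype J] [DecidableEq J] [DecidableEq β] (blk : J → β)
    (hblk : ∀ j, 2 * k + 1 ≤ (Finset.univ.filter fun a => blk a = blk j).card)
    {F : J → J → SeqQ A} (hadj : ∀ a b, Adj (F a b) (F b a))
    (kF : ∀ c a b, F a b * cst c = cst c * F a b)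
    (hF1 : ∀ a b d, blk a = blk b → blk b = blk d → F a b * F b d = F a d)
    (hF0 : ∀ a b c d, b ≠ c → F a b * F c d = 0)
    (hsum : ∑ a, F a a = 1) : Reach e (cst p) (cst q) := by
  have hvp : v * p = v := pi_right hp hv
  have hvq : star v * q = star v := pi_right hq (by rw [star_star, hv'])
  have hqv : q * v = v := by
    have := congrArg star hvq
    simpa [hq.1.star_eq] using this
  have hpv : p * star v = star v := by
    have := congrArg star hvp
    simpa [hp.1.star_eq] using this
  let σ : Finset J → J → A := fun D a => if a ∈ D then q else p
  have key : ∀ D : Finset J, Reach e (cst p) (∑ a, cst (σ D a) * F a a) := by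
    intro D
    induction D using Finset.induction_on with
    | empty =>
      have : ∑ a, cst (σ ∅ a) * F a a = cst p := by
        simp only [σ, Finset.notMem_empty, if_false]
        rw [← Finset.mul_sum, hsum, mul_one]
      rw [this]; exact Reach.refl _ _
    | insert j D hj ih =>
      refine ih.trans ?_
      set T : SeqQ A := ∑ a ∈ Finset.univ.erase j, cst (σ D a) * F a a with hT
      have h1 : ∑ a, cst (σ D a) * F a a = T + cst p * F j j := by
        rw [hT, ← Finset.sum_erase_add _ _ (Finset.mem_univ j)]
        simp [σ, hj]
      have h2 : ∑ a, cst (σ (insert j D) a) * F a a = T + cst q * F j j := by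
        rw [hT, ← Finset.sum_erase_add _ _ (Finset.mem_univ j)]
        congr 1
        · refine Finset.sum_congr rfl fun a ha => ?_
          simp [σ, Finset.ne_of_mem_erase ha]
        · simp [σ]
      rw [h1, h2]
      have hTg : T * F j j = 0 := by
        rw [hT, Finset.sum_mul]; refine Finset.sum_eq_zero fun a ha => ?_
        rw [mul_assoc, hF0 _ _ _ _ (Finset.ne_of_mem_erase ha), mul_zero]
      have hgT : F j j * T = 0 := by
        rw [hT, Finset.mul_sum]; refine Finset.sum_eq_zero fun a ha => ?_
        rw [← mul_assoc, kF, mul_assoc, hF0 _ _ _ _ (Finset.ne_of_mem_erase ha).symm, mul_zero]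
      have hTl : ∀ l, l ≠ j → T * F l j = cst (σ D l) * F l j := by
        intro l hl
        rw [hT, Finset.sum_mul, Finset.sum_eq_single l]
        · rw [mul_assoc, show F l l * F l j = F l j from ?_]
          have e1 : F l j = (∑ a, F a a) * F l j := by rw [hsum, one_mul]
          rw [Finset.sum_mul, Finset.sum_eq_single l] at e1
          · exact e1.symm
          · intro a _ ha; exact hF0 _ _ _ _ ha
          · simp
        · intro a _ ha; rw [mul_assoc, hF0 _ _ _ _ ha, mul_zero]
        · intro h; exact absurd (Finset.mem_erase.2 ⟨hl, Finset.mem_univ _⟩) h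
      have hTl' : ∀ l, l ≠ j → F j l * T = F j l * cst (σ D l) := by
        intro l hl
        rw [hT, Finset.mul_sum, Finset.sum_eq_single l]
        · rw [← mul_assoc, kF, mul_assoc, show F j l * F l l = F j l from ?_]
          have e1 : F j l = F j l * (∑ a, F a a) := by rw [hsum, mul_one]
          rw [Finset.mul_sum, Finset.sum_eq_single l] at e1
          · exact e1.symm
          · intro a _ ha; exact hF0 _ _ _ _ ha.symm
          · simp
        · intro a _ ha; rw [← mul_assoc, kF, mul_assoc, hF0 _ _ _ _ ha.symm, mul_zero]
        · intro h; exact absurd (Finset.mem_erase.2 ⟨hl, Finset.mem_univ _⟩) h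
      set B := (Finset.univ.filter fun a => blk a = blk j).erase j with hB
      have hBc : 2 * k ≤ B.card := by
        rw [hB, Finset.card_erase_of_mem (by simp)]
        have := hblk j; omega
      have hBD := Finset.card_filter_add_card_filter_not (s := B) (fun a => a ∈ D)
      have hBj : ∀ a ∈ B, a ≠ j ∧ blk a = blk j := by
        intro a ha; simpa [hB] using ha
      rcases le_total k (B.filter fun a => a ∈ D).card with hk | hk
      · -- helpers in D
        obtain ⟨l, hl, hl'⟩ := exists_helpers hk
        have hlj : ∀ i, l i ≠ j := fun i => (hBj _ (Finset.mem_filter.1 (hl' i)).1).1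
        have hlb : ∀ i, blk (l i) = blk j := fun i => (hBj _ (Finset.mem_filter.1 (hl' i)).1).2
        have hlD : ∀ i, l i ∈ D := fun i => (Finset.mem_filter.1 (hl' i)).2
        refine Reach.symm he.1.star_eq ?_
        refine reach_coord (v := star v) he hq hqe heq hpe hep (by rw [star_star, hv'])
          (by rw [star_star, hv]) hvq hpv hy (g := F j j) (T := T) (c := fun i => F (l i) j)
          (c' := fun i => F j (l i)) (fun i => hadj _ _) (fun a => kF _ _ _) (fun a i => kF _ _ _)
          (fun a i => kF _ _ _) (fun i => hF1 _ _ _ (hlb i) rfl)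
          (fun i => hF0 _ _ _ _ (hlj i).symm) (fun i => hF0 _ _ _ _ (hlj i))
          (fun i => hF1 _ _ _ rfl (hlb i).symm) (fun i => hF1 _ _ _ (hlb i).symm (hlb i))
          (fun i m him => hF0 _ _ _ _ fun h => him (hl h)) hTg hgT (fun i => ?_) (fun i => ?_)
        · rw [hTl _ (hlj i)]; simp [σ, hlD i]
        · rw [hTl' _ (hlj i)]; simp [σ, hlD i]
      · have hk' : k ≤ (B.filter fun a => ¬ a ∈ D).card := by omega
        obtain ⟨l, hl, hl'⟩ := exists_helpers hk'
        have hlj : ∀ i, l i ≠ j := fun i => (hBj _ (Finset.mem_filter.1 (hl' i)).1).1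
        have hlb : ∀ i, blk (l i) = blk j := fun i => (hBj _ (Finset.mem_filter.1 (hl' i)).1).2
        have hlD : ∀ i, l i ∉ D := fun i => (Finset.mem_filter.1 (hl' i)).2
        refine reach_coord (v := v) he hp hpe hep hqe heq hv
          hv' hvp hqv hx (g := F j j) (T := T) (c := fun i => F (l i) j)
          (c' := fun i => F j (l i)) (fun i => hadj _ _) (fun a => kF _ _ _) (fun a i => kF _ _ _)
          (fun a i => kF _ _ _) (fun i => hF1 _ _ _ (hlb i) rfl)
          (fun i => hF0 _ _ _ _ (hlj i).symm) (fun i => hF0 _ _ _ _ (hlj i))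
          (fun i => hF1 _ _ _ rfl (hlb i).symm) (fun i => hF1 _ _ _ (hlb i).symm (hlb i))
          (fun i m him => hF0 _ _ _ _ fun h => him (hl h)) hTg hgT (fun i => ?_) (fun i => ?_)
        · rw [hTl _ (hlj i)]; simp [σ, hlD i]
        · rw [hTl' _ (hlj i)]; simp [σ, hlD i]
  have := key Finset.univ
  simp only [σ, Finset.mem_univ, if_true] at this
  rwa [← Finset.mul_sum, hsum, mul_one] at this

/-- matrix units of `M_N ⊕ M_{N+1}` -/
def EU (N : ℕ) : Fin N ⊕ Fin (N + 1) → Fin N ⊕ Fin (N + 1) →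
    Matrix (Fin N) (Fin N) ℂ × Matrix (Fin (N + 1)) (Fin (N + 1)) ℂ
  | Sum.inl i, Sum.inl j => (Matrix.single i j 1, 0)
  | Sum.inr i, Sum.inr j => (0, Matrix.single i j 1)
  | _, _ => 0

lemma EU_mul (N : ℕ) (a b d : Fin N ⊕ Fin (N + 1)) (h1 : a.isLeft = b.isLeft)
    (h2 : b.isLeft = d.isLeft) : EU N a b * EU N b d = EU N a d := by
  rcases a with a | a <;> rcases b with b | b <;> rcases d with d | d <;>
    simp_all [EU]

lemma EU_mul_ne (N : ℕ) (a b c d : Fin N ⊕ Fin (N + 1)) (h : b ≠ c) :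
    EU N a b * EU N c d = 0 := by
  rcases a with a | a <;> rcases b with b | b <;> rcases c with c | c <;> rcases d with d | d <;>
    simp_all [EU, Matrix.single_mul_single_of_ne]

lemma EU_star (N : ℕ) (a b : Fin N ⊕ Fin (N + 1)) : star (EU N a b) = EU N b a := by
  rcases a with a | a <;> rcases b with b | b <;>
    simp [EU, Prod.star_def, Matrix.star_eq_conjTranspose, Matrix.conjTranspose_single]

lemma EU_sum (N : ℕ) : ∑ a, EU N a a = 1 := by
  rw [Fintype.sum_sum_type]
  ext i j
  · simp [EU, Prod.fst_sum, Matrix.sum_apply, Matrix.single_apply, Matrix.one_apply]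
    by_cases h : i = j <;> simp [h]; exact Finset.card_eq_one.2 ⟨j, by ext; simp⟩
  · simp [EU, Prod.snd_sum, Matrix.sum_apply, Matrix.single_apply, Matrix.one_apply]
    by_cases h : i = j <;> simp [h]; exact Finset.card_eq_one.2 ⟨j, by ext; simp⟩

lemma norm_le_one_of_idem {x : A} (h : (star x * x) * (star x * x) = star x * x) : ‖x‖ ≤ 1 := by
  have h1 : ‖star x * x‖ * ‖star x * x‖ = ‖star x * x‖ := by
    rw [← CStarRing.norm_star_mul_self (x := star x * x)]
    simp only [star_mul, star_star]; rw [h]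
  rw [CStarRing.norm_star_mul_self] at h1
  by_contra hc
  push Not at hc
  nlinarith [mul_pos (show (0:ℝ) < ‖x‖ by linarith) (show (0:ℝ) < ‖x‖ by linarith),
    mul_self_nonneg (‖x‖ - 1)]

lemma norm_EU_le {N : ℕ}
    (φ : (Matrix (Fin N) (Fin N) ℂ × Matrix (Fin (N + 1)) (Fin (N + 1)) ℂ) →⋆ₐ[ℂ] A)
    (a b : Fin N ⊕ Fin (N + 1)) : ‖φ (EU N a b)‖ ≤ 1 := by
  apply norm_le_one_of_idem
  rw [← map_star, EU_star, ← map_mul, ← map_mul]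
  congr 1
  rcases a with a | a <;> rcases b with b | b <;> simp [EU]

lemma reach_pq [PartialOrder A] [StarOrderedRing A] (hsimple : IsSimpleCStarAlgebra A)
    (hdiv : ApproximatelyDivisible A)
    {e p q : A} (he : IsProjection e) (hp : IsProjection p) (hq : IsProjection q)
    (hpe : p * e = p) (hep : e * p = p) (hqe : q * e = q) (heq : e * q = q)
    (hpq : MvNEquiv p q) (hp1 : p ≠ e) (hq1 : q ≠ e) :
    Reach e (cst p) (cst q) := by
  obtain ⟨v, hv, hv'⟩ := hpq
  have hr : ∀ {p : A}, IsProjection p → p * e = p → e * p = p → IsProjection (e - p) := by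
    intro p hp hpe hep
    exact ⟨he.1.sub hp.1, by simp [mul_sub, sub_mul, he.2, hpe, hep, hp.2]⟩
  obtain ⟨k, x, hx⟩ := full_of_simple hsimple (hr hp hpe hep) (sub_ne_zero.2 hp1.symm)
  obtain ⟨l, y, hy⟩ := full_of_simple hsimple (hr hq hqe heq) (sub_ne_zero.2 hq1.symm)
  obtain ⟨x, hx⟩ := full_pad hx l
  have hy' := full_pad hy k
  rw [add_comm l k] at hy'
  obtain ⟨y, hy⟩ := hy'
  generalize k + l = K at x y
  obtain ⟨φ, hφ⟩ := hdiv (2 * K + 1) (by omega)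
  let G : Fin (2 * K + 1) ⊕ Fin (2 * K + 1 + 1) → Fin (2 * K + 1) ⊕ Fin (2 * K + 1 + 1) → BSeq A :=
    fun a b => BoundedContinuousFunction.ofNormedAddCommGroupDiscrete
      (fun n => φ n (EU (2 * K + 1) a b)) 1 (fun n => norm_EU_le _ _ _)
  have hG : ∀ a b n, G a b n = φ n (EU (2 * K + 1) a b) := fun _ _ _ => rfl
  refine reach_all he hp hq hpe hep hqe heq hv hv' hx hy (J := Fin (2 * K + 1) ⊕ Fin (2 * K + 1 + 1))
    Sum.isLeft ?_ (F := fun a b => mkQ (G a b)) ?_ ?_ ?_ ?_ ?_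
  · rintro (j | j)
    · have hc := Finset.card_image_of_injective (Finset.univ : Finset (Fin (2 * K + 1)))
        (Sum.inl_injective (α := Fin (2 * K + 1)) (β := Fin (2 * K + 1 + 1)))
      rw [Finset.card_univ, Fintype.card_fin] at hc
      refine le_trans (by omega) (hc.symm.le.trans (Finset.card_le_card fun a ha => ?_))
      obtain ⟨x, _, rfl⟩ := Finset.mem_image.1 ha
      exact Finset.mem_filter.2 ⟨Finset.mem_univ _, rfl⟩
    · have hc := Finset.card_image_of_injective (Finset.univ : Finset (Fin (2 * K + 1 + 1)))
        (Sum.inr_injective (α := Fin (2 * K + 1)) (β := Fin (2 * K + 1 + 1)))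
      rw [Finset.card_univ, Fintype.card_fin] at hc
      refine le_trans (by omega) (hc.symm.le.trans (Finset.card_le_card fun a ha => ?_))
      obtain ⟨x, _, rfl⟩ := Finset.mem_image.1 ha
      exact Finset.mem_filter.2 ⟨Finset.mem_univ _, rfl⟩
  · intro a b
    refine ⟨G a b, rfl, ?_⟩
    congr 1; ext n
    change star (G a b n) = _
    rw [hG, hG, ← map_star, EU_star]
  · intro c a b
    change mkQ (G a b) * cst c = cst c * mkQ (G a b)
    rw [cst_apply, ← map_mul, ← map_mul, mkQ_eq, tendsto_zero_iff_norm_tendsto_zero]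
    exact hφ _ c
  · intro a b d h1 h2
    change mkQ (G a b) * mkQ (G b d) = mkQ (G a d)
    rw [← map_mul]; congr 1; ext n
    change G a b n * G b d n = _
    rw [hG, hG, hG, ← map_mul, EU_mul _ _ _ _ h1 h2]
  · intro a b c d h
    change mkQ (G a b) * mkQ (G c d) = 0
    rw [← map_mul, ← map_zero mkQ]; congr 1; ext n
    change G a b n * G c d n = 0
    rw [hG, hG, ← map_mul, EU_mul_ne _ _ _ _ _ h, map_zero]
  · change ∑ a, mkQ (G a a) = 1
    rw [← map_sum, ← map_one mkQ]; congr 1; ext n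
    rw [BoundedContinuousFunction.sum_apply]
    simp only [hG]
    rw [← map_sum, EU_sum, map_one]; rfl

end Units
section LemmaTwo
variable {A : Type*} [CStarAlgebra A]

lemma finite_one (hsf : StablyFinite A) {s : A} (h : star s * s = 1) : s * star s = 1 := by
  have h2 := hsf 1 (Matrix.of fun _ _ => s) (by
    ext i j
    simp [Matrix.mul_apply, Matrix.star_apply, h, Matrix.one_apply, Subsingleton.elim i j])
  have := congrFun (congrFun h2 0) 0
  simpa [Matrix.mul_apply, Matrix.star_apply] using this

lemma finite_proj (hsf : StablyFinite A) {e q v : A} (he : IsProjection e) (hq : IsProjection q)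
    (hqe : q * e = q) (heq : e * q = q) (hv : star v * v = e) (hv' : v * star v = q) : q = e := by
  have h1 : v * e = v := pi_right he hv
  have h2 : star v * q = star v := pi_right hq (by rw [star_star, hv'])
  have h2' : q * v = v := by
    have := congrArg star h2
    simpa [hq.1.star_eq] using this
  have h1' : e * star v = star v := by
    have := congrArg star h1
    simpa [he.1.star_eq] using this
  have h3 : e * v = v := by rw [← h2', ← mul_assoc, heq]
  have h3' : star v * e = star v := by
    have := congrArg star h3
    simpa [he.1.star_eq] using this
  have := finite_one hsf (s := (1 - e) + v) (by
    rw [star_add, star_sub, star_one, he.1.star_eq]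
    simp only [mul_add, add_mul, mul_sub, sub_mul, mul_one, one_mul, he.2, h3, h3', hv]
    abel)
  rw [star_add, star_sub, star_one, he.1.star_eq] at this
  simp only [mul_add, add_mul, mul_sub, sub_mul, mul_one, one_mul, he.2, h1, h1', hv'] at this
  have h4 : q - e = 0 := by
    have h5 := sub_eq_zero.2 this
    rw [← h5]; abel
  exact sub_eq_zero.1 h4

lemma exists_good [PartialOrder A] [StarOrderedRing A] (hsimple : IsSimpleCStarAlgebra A)
    (hdiv : ApproximatelyDivisible A) (hsf : StablyFinite A)
    {e p q : A} (he : IsProjection e) (hp : IsProjection p) (hq : IsProjection q)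
    (hpe : p * e = p) (hep : e * p = p) (hqe : q * e = q) (heq : e * q = q)
    (hpq : MvNEquiv p q) : ∃ w, GoodPath e w ∧ w * p * star w = q := by
  by_cases hp1 : p = e
  · obtain ⟨v, hv, hv'⟩ := hpq
    have := finite_proj hsf he hq hqe heq (hp1 ▸ hv) hv'
    exact ⟨1, GoodPath.one e, by simp [hp1, this]⟩
  by_cases hq1 : q = e
  · obtain ⟨v, hv, hv'⟩ := hpq
    have := finite_proj hsf (v := star v) he hp hpe hep (by rw [star_star, ← hq1, hv'])
      (by rw [star_star, hv])
    exact absurd this hp1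
  obtain ⟨w, hw, hwq⟩ := reach_pq hsimple hdiv he hp hq hpe hep hqe heq hpq hp1 hq1
  rw [cst_apply, cst_apply, ← map_mul, ← map_mul, mkQ_eq] at hwq
  have hev := (tendsto_zero_iff_norm_tendsto_zero.1 hwq).eventually
    (gt_mem_nhds (show (0 : ℝ) < 1 / 2 by norm_num))
  obtain ⟨n, hn⟩ := hev.exists
  change ‖w n * p * star (w n) - q‖ < 1 / 2 at hn
  have hg := hw n
  generalize w n = u at hn hg
  have hu := Unitary.mem_iff.1 hg.mem
  have hc : e * u = u * e := by
    obtain ⟨γ, h1, h2, h3, h4, h5⟩ := hg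
    have := h5 1 (1 - e) (by rw [sub_mul, one_mul, he.2, sub_self])
      (by rw [mul_sub, mul_one, he.2, sub_self])
    rw [h3, Commute, SemiconjBy, sub_mul, mul_sub, one_mul, mul_one] at this
    exact sub_right_injective this
  have hc' : star u * e = e * star u := by
    have := congrArg star hc
    simpa [he.1.star_eq] using this
  obtain ⟨w', hw', h'⟩ := near_projections (e := e) (p := u * p * star u) (q := q) he.1.star_eq
    ⟨by rw [isSelfAdjoint_iff]; simp [hp.1.star_eq, mul_assoc], by
      calc u * p * star u * (u * p * star u) = u * p * (star u * u) * p * star u := by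
            simp only [mul_assoc]
        _ = _ := by rw [hu.1, mul_one, mul_assoc u, hp.2]⟩ hq
    (by rw [mul_assoc, hc', ← mul_assoc, mul_assoc u, hpe])
    (by rw [← mul_assoc, ← mul_assoc, hc, mul_assoc u, hep]) hqe heq hn
  exact ⟨w' * u, hw'.mul hg, by rw [← h', star_mul]; simp only [mul_assoc]⟩

end LemmaTwo
section Glue
variable {A : Type*} [CStarAlgebra A]

lemma conj_proj {u p : A} (hu : u ∈ unitary A) (hp : IsProjection p) :
    IsProjection (u * p * star u) := by
  have hu := Unitary.mem_iff.1 hu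
  refine ⟨by rw [isSelfAdjoint_iff]; simp [hp.1.star_eq, mul_assoc], ?_⟩
  calc u * p * star u * (u * p * star u) = u * p * (star u * u) * p * star u := by
        simp only [mul_assoc]
    _ = _ := by rw [hu.1, mul_one, mul_assoc u, hp.2]

lemma sum_proj {q : ℕ → A} (hq : ∀ i, IsProjection (q i))
    (hort : ∀ i j, i ≠ j → q i * q j = 0) (n i : ℕ) :
    q i * (∑ j ∈ Finset.range n, q j) = (if i < n then q i else 0) ∧
    (∑ j ∈ Finset.range n, q j) * q i = (if i < n then q i else 0) := by
  constructor
  · rw [Finset.mul_sum]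
    split_ifs with h
    · rw [Finset.sum_eq_single i, (hq i).2]
      · intro j _ hj; exact hort _ _ hj.symm
      · intro hh; exact absurd (Finset.mem_range.2 h) hh
    · refine Finset.sum_eq_zero fun j hj => hort _ _ ?_
      have := Finset.mem_range.1 hj; omega
  · rw [Finset.sum_mul]
    split_ifs with h
    · rw [Finset.sum_eq_single i, (hq i).2]
      · intro j _ hj; exact hort _ _ hj
      · intro hh; exact absurd (Finset.mem_range.2 h) hh
    · refine Finset.sum_eq_zero fun j hj => hort _ _ ?_
      have := Finset.mem_range.1 hj; omega

lemma one_step [PartialOrder A] [StarOrderedRing A] (hsimple : IsSimpleCStarAlgebra A)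
    (hdiv : ApproximatelyDivisible A) (hsf : StablyFinite A)
    {p q : ℕ → A} (hp : ∀ i, IsProjection (p i)) (hq : ∀ i, IsProjection (q i))
    (horthp : ∀ i j, i ≠ j → p i * p j = 0) (horthq : ∀ i j, i ≠ j → q i * q j = 0)
    (hmvn : ∀ i, MvNEquiv (p i) (q i)) (n : ℕ) {u : A} (hu : u ∈ unitary A)
    (hup : ∀ i < n, u * p i * star u = q i) :
    ∃ γ : ℝ → A, Continuous γ ∧ γ 0 = 1 ∧ (∀ t, γ t ∈ unitary A) ∧
      (∀ t, ∀ i < n, Commute (q i) (γ t)) ∧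
      ∀ i < n + 1, (γ 1 * u) * p i * star (γ 1 * u) = q i := by
  have hu' := Unitary.mem_iff.1 hu
  set Q := ∑ j ∈ Finset.range n, q j with hQ
  have hQs := sum_proj hq horthq n
  have hQsa : star Q = Q := by
    rw [hQ, star_sum]; exact Finset.sum_congr rfl fun i _ => (hq i).1.star_eq
  have hQQ : Q * Q = Q := by
    conv_lhs => rw [hQ, Finset.sum_mul]
    rw [hQ]
    refine Finset.sum_congr rfl fun i hi => ?_
    rw [(hQs i).1, if_pos (Finset.mem_range.1 hi)]
  have he : IsProjection (1 - Q) :=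
    ⟨by rw [isSelfAdjoint_iff, star_sub, star_one, hQsa], by
      simp [mul_sub, sub_mul, hQQ]⟩
  have hPQ : u * p n * star u * Q = 0 := by
    rw [hQ, Finset.mul_sum]
    refine Finset.sum_eq_zero fun i hi => ?_
    have hi := Finset.mem_range.1 hi
    rw [← hup i hi]
    calc u * p n * star u * (u * p i * star u) = u * p n * (star u * u) * p i * star u := by
          simp only [mul_assoc]
      _ = _ := by rw [hu'.1, mul_one, mul_assoc u, horthp _ _ (by omega)]; simp
  have hP := conj_proj hu (hp n)
  have hQP : Q * (u * p n * star u) = 0 := by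
    have := congrArg star hPQ
    rwa [star_mul, hQsa, hP.1.star_eq, star_zero] at this
  have hqn := hQs n
  simp only [lt_irrefl, if_false] at hqn
  obtain ⟨v, hv, hv'⟩ := hmvn n
  obtain ⟨w, ⟨γ, h1, h2, h3, h4, h5⟩, hw⟩ := exists_good hsimple hdiv hsf he hP (hq n)
    (by rw [mul_sub, hPQ]; simp) (by rw [sub_mul, hQP]; simp)
    (by rw [mul_sub, hqn.1]; simp) (by rw [sub_mul, hqn.2]; simp)
    ⟨v * star u, by
      rw [star_mul, star_star, ← hv]; simp only [mul_assoc], by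
      rw [star_mul, star_star, mul_assoc, ← mul_assoc (star u), hu'.1, one_mul, hv']⟩
  have hcom : ∀ t, ∀ i < n, Commute (q i) (γ t) := by
    intro t i hi
    have := hQs i
    rw [if_pos hi] at this
    exact h5 t _ (by rw [mul_sub, this.1]; simp) (by rw [sub_mul, this.2]; simp)
  refine ⟨γ, h1, h2, h4, hcom, fun i hi => ?_⟩
  rw [star_mul]
  have : γ 1 * u * p i * (star u * star (γ 1)) = γ 1 * (u * p i * star u) * star (γ 1) := by
    simp only [mul_assoc]
  rw [this]
  rcases Nat.lt_succ_iff_lt_or_eq.1 hi with hi | rfl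
  · rw [hup i hi, ← (hcom 1 i hi).eq, mul_assoc, (Unitary.mem_iff.1 (h4 1)).2, mul_one]
  · rw [h3, hw]

lemma all_steps [PartialOrder A] [StarOrderedRing A] (hsimple : IsSimpleCStarAlgebra A)
    (hdiv : ApproximatelyDivisible A) (hsf : StablyFinite A)
    {p q : ℕ → A} (hp : ∀ i, IsProjection (p i)) (hq : ∀ i, IsProjection (q i))
    (horthp : ∀ i j, i ≠ j → p i * p j = 0) (horthq : ∀ i j, i ≠ j → q i * q j = 0)
    (hmvn : ∀ i, MvNEquiv (p i) (q i)) :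
    ∃ (g : ℕ → ℝ → A) (U : ℕ → A), (∀ n, Continuous (g n)) ∧ (∀ n, g n 0 = 1) ∧
      (∀ n t, g n t ∈ unitary A) ∧ U 0 = 1 ∧ (∀ n, U (n + 1) = g n 1 * U n) ∧
      (∀ n t, ∀ i < n, Commute (q i) (g n t)) ∧ ∀ n, ∀ i < n, U n * p i * star (U n) = q i := by
  have key : ∀ (n : ℕ) (u : A), ∃ γ : ℝ → A, Continuous γ ∧ γ 0 = 1 ∧ (∀ t, γ t ∈ unitary A) ∧
      ((u ∈ unitary A ∧ ∀ i < n, u * p i * star u = q i) →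
      (∀ t, ∀ i < n, Commute (q i) (γ t)) ∧
      ∀ i < n + 1, (γ 1 * u) * p i * star (γ 1 * u) = q i) := by
    intro n u
    by_cases h : u ∈ unitary A ∧ ∀ i < n, u * p i * star u = q i
    · obtain ⟨γ, h1, h2, h3, h4⟩ := one_step hsimple hdiv hsf hp hq horthp horthq hmvn n h.1 h.2
      exact ⟨γ, h1, h2, h3, fun _ => h4⟩
    · exact ⟨fun _ => 1, continuous_const, rfl, fun _ => one_mem _, fun h' => absurd h' h⟩
  choose Γ h1 h2 h3 h4 using key
  let U : ℕ → A := fun n => Nat.rec 1 (fun n u => Γ n u 1 * u) n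
  have hU : ∀ n, U (n + 1) = Γ n (U n) 1 * U n := fun n => rfl
  have hUP : ∀ n, U n ∈ unitary A ∧ ∀ i < n, U n * p i * star (U n) = q i := by
    intro n
    induction n with
    | zero => exact ⟨one_mem _, by simp⟩
    | succ n ih =>
      rw [hU]
      exact ⟨mul_mem (h3 _ _ _) ih.1, (h4 n _ ih).2⟩
  exact ⟨fun n => Γ n (U n), U, fun n => h1 _ _, fun n => h2 _ _, fun n => h3 _ _, rfl, hU,
    fun n => (h4 n _ (hUP n)).1, fun n => (hUP n).2⟩

/-- reparametrisation -/
noncomputable def sfun (n : ℕ) (t : ℝ) : ℝ := max 0 (min 1 (2 ^ (n + 1) * (t - 1) + 2))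

lemma sfun_cont (n : ℕ) : Continuous (sfun n) := by unfold sfun; fun_prop

lemma sfun_zero (n : ℕ) : sfun n 0 = 0 := by
  unfold sfun
  have : (2 : ℝ) ≤ 2 ^ (n + 1) := by
    rw [pow_succ]; nlinarith [one_le_pow₀ (show (1 : ℝ) ≤ 2 by norm_num) (n := n)]
  exact max_eq_left ((min_le_right _ _).trans (by linarith))

lemma sfun_one (n : ℕ) : sfun n 1 = 1 := by
  unfold sfun; norm_num

lemma sfun_eq_one {n i : ℕ} {t : ℝ} (h : sfun n t ≠ 0) (hi : i < n) : sfun i t = 1 := by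
  have h1 : 0 < 2 ^ (n + 1) * (t - 1) + 2 := by
    by_contra hc
    push Not at hc
    exact h (max_eq_left ((min_le_right _ _).trans hc))
  have h2 : (1 : ℝ) ≤ 2 ^ (i + 1) * (t - 1) + 2 := by
    have h3 : (2 : ℝ) ^ (i + 1) ≤ 2 ^ n := pow_le_pow_right₀ (by norm_num) hi
    have h4 : (0 : ℝ) < 2 ^ (i + 1) := by positivity
    rw [pow_succ (2 : ℝ) n] at h1
    rcases le_total 0 (t - 1) with h0 | h0
    · nlinarith
    · nlinarith
  unfold sfun
  rw [min_eq_left h2]; norm_num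

lemma sfun_eventually {t : ℝ} (ht : t < 1) : ∃ M, ∀ n, M ≤ n → sfun n t = 0 := by
  obtain ⟨M, hM⟩ := pow_unbounded_of_one_lt (2 / (1 - t)) (show (1 : ℝ) < 2 by norm_num)
  refine ⟨M, fun n hn => ?_⟩
  have h3 : (2 : ℝ) ^ M ≤ 2 ^ (n + 1) := pow_le_pow_right₀ (by norm_num) (by omega)
  rw [div_lt_iff₀ (by linarith)] at hM
  unfold sfun
  refine max_eq_left ((min_le_right _ _).trans ?_)
  nlinarith

lemma norm_conj_le {u x : A} (hu : u ∈ unitary A) : ‖u * x * star u‖ ≤ ‖x‖ := by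
  have h1 := norm_unitary_le_one hu
  calc ‖u * x * star u‖ ≤ ‖u‖ * ‖x‖ * ‖star u‖ :=
        (norm_mul_le _ _).trans (by gcongr; exact norm_mul_le _ _)
    _ ≤ 1 * ‖x‖ * 1 := by rw [norm_star]; gcongr
    _ = ‖x‖ := by ring

lemma norm_proj_le {p : A} (hp : IsProjection p) : ‖p‖ ≤ 1 := by
  apply norm_le_one_of_idem
  rw [hp.1.star_eq, hp.2, hp.2]

lemma tail_bound {p : ℕ → A} (hp : ∀ i, IsProjection (p i)) {a : A}
    (ha : Tendsto (fun n => ∑ i ∈ Finset.range n, ((1 : ℝ) / 2) ^ (i + 1) • p i) atTop (𝓝 a))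
    (n : ℕ) : ‖a - ∑ i ∈ Finset.range n, ((1 : ℝ) / 2) ^ (i + 1) • p i‖ ≤ 1 / 2 ^ n := by
  have := dist_le_of_le_geometric_two_of_tendsto (C := 1)
    (f := fun n => ∑ i ∈ Finset.range n, ((1 : ℝ) / 2) ^ (i + 1) • p i) (fun m => ?_) ha n
  · rwa [dist_comm, dist_eq_norm] at this
  · rw [Finset.sum_range_succ, dist_eq_norm, sub_add_cancel_left, norm_neg, norm_smul]
    have h1 : ‖((1 : ℝ) / 2) ^ (m + 1)‖ = 1 / 2 / 2 ^ m := by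
      rw [Real.norm_of_nonneg (by positivity), pow_succ, div_pow, one_pow]; ring
    rw [h1]
    exact mul_le_of_le_one_right (by positivity) (norm_proj_le (hp m))

lemma cuntz_le {p q : ℕ → A} (hp : ∀ i, IsProjection (p i))
    (horthp : ∀ i j, i ≠ j → p i * p j = 0)
    {v : ℕ → A} (hv : ∀ i, star (v i) * v i = p i) (hv' : ∀ i, v i * star (v i) = q i)
    {a b : A}
    (ha : Tendsto (fun n => ∑ i ∈ Finset.range n, ((1 : ℝ) / 2) ^ (i + 1) • p i) atTop (𝓝 a))
    (hb : Tendsto (fun n => ∑ i ∈ Finset.range n, ((1 : ℝ) / 2) ^ (i + 1) • q i) atTop (𝓝 b)) :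
    CuntzLE b a := by
  have hvp : ∀ i, v i * p i = v i := fun i => pi_right (hp i) (hv i)
  have hpv : ∀ i, p i * star (v i) = star (v i) := fun i => by
    have := congrArg star (hvp i)
    simpa [(hp i).1.star_eq] using this
  have hpa : ∀ i, p i * a = ((1 : ℝ) / 2) ^ (i + 1) • p i := by
    intro i
    refine tendsto_nhds_unique (ha.const_mul (p i)) ?_
    refine tendsto_const_nhds.congr' ?_
    filter_upwards [eventually_gt_atTop i] with n hn
    rw [Finset.mul_sum, Finset.sum_eq_single i]
    · rw [mul_smul_comm, (hp i).2]
    · intro j _ hj; rw [mul_smul_comm, horthp _ _ hj.symm, smul_zero]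
    · intro h; exact absurd (Finset.mem_range.2 hn) h
  refine ⟨fun n => ∑ i ∈ Finset.range n, v i, ?_⟩
  have : ∀ n, (∑ i ∈ Finset.range n, v i) * a * star (∑ i ∈ Finset.range n, v i) =
      ∑ i ∈ Finset.range n, ((1 : ℝ) / 2) ^ (i + 1) • q i := by
    intro n
    rw [star_sum, Finset.sum_mul, Finset.sum_mul]
    refine Finset.sum_congr rfl fun i hi => ?_
    have h1 : v i * a = ((1 : ℝ) / 2) ^ (i + 1) • v i := by
      rw [← hvp i, mul_assoc, hpa, mul_smul_comm]
    rw [h1, Finset.mul_sum, Finset.sum_eq_single i]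
    · rw [smul_mul_assoc, hv']
    · intro j _ hj
      rw [smul_mul_assoc, ← hvp i, ← hpv j, mul_assoc, ← mul_assoc (p i), horthp _ _ hj.symm]
      simp
    · intro h; exact absurd hi h
  simp only [this]
  exact tendsto_iff_norm_sub_tendsto_zero.1 hb

lemma sum_nonneg_proj [PartialOrder A] [StarOrderedRing A] {p : ℕ → A}
    (hp : ∀ i, IsProjection (p i)) {a : A}
    (ha : Tendsto (fun n => ∑ i ∈ Finset.range n, ((1 : ℝ) / 2) ^ (i + 1) • p i) atTop (𝓝 a)) :
    0 ≤ a := by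
  refine ge_of_tendsto' ha fun n => Finset.sum_nonneg fun i _ => smul_nonneg (by positivity) ?_
  have := star_mul_self_nonneg (p i)
  rwa [(hp i).1.star_eq, (hp i).2] at this

end Glue
theorem homotopy_between_projection_sums {A : Type*} [CStarAlgebra A] [PartialOrder A]
    [StarOrderedRing A] [TopologicalSpace.SeparableSpace A]
    (hsimple : IsSimpleCStarAlgebra A)
    (hdiv : ApproximatelyDivisible A)
    (hsf : StablyFinite A)
    (p q : ℕ → A) (hp : ∀ i, IsProjection (p i)) (hq : ∀ i, IsProjection (q i))
    (horthp : ∀ i j, i ≠ j → p i * p j = 0) (horthq : ∀ i j, i ≠ j → q i * q j = 0)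
    (hmvn : ∀ i, MvNEquiv (p i) (q i))
    (a b : A)
    (ha : Tendsto (fun n => ∑ i ∈ Finset.range n, ((1 : ℝ) / 2) ^ (i + 1) • p i) atTop (𝓝 a))
    (hb : Tendsto (fun n => ∑ i ∈ Finset.range n, ((1 : ℝ) / 2) ^ (i + 1) • q i) atTop (𝓝 b)) :
    ∃ h : ℝ → A, ContinuousOn h (Set.Icc 0 1) ∧ h 0 = a ∧ h 1 = b ∧
      ∀ t ∈ Set.Icc (0 : ℝ) 1, 0 ≤ h t ∧ CuntzEquiv (h t) a := by
  obtain ⟨g, U, g1, g2, g3, U0, U1, gc, Up⟩ :=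
    all_steps hsimple hdiv hsf hp hq horthp horthq hmvn
  let W : ℕ → ℝ → A := fun n => Nat.rec (fun _ => 1) (fun n w t => g n (sfun n t) * w t) n
  have W0 : ∀ t, W 0 t = 1 := fun _ => rfl
  have W1 : ∀ n t, W (n + 1) t = g n (sfun n t) * W n t := fun _ _ => rfl
  have Wc : ∀ n, Continuous (W n) := by
    intro n
    induction n with
    | zero => exact continuous_const
    | succ n ih => exact ((g1 n).comp (sfun_cont n)).mul ih
  have Wu : ∀ n t, W n t ∈ unitary A := by
    intro n t
    induction n with
    | zero => exact one_mem _
    | succ n ih => exact mul_mem (g3 _ _) ih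
  have WU : ∀ n t, (∀ i < n, sfun i t = 1) → W n t = U n := by
    intro n t
    induction n with
    | zero => intro _; rw [W0, U0]
    | succ n ih =>
      intro h
      rw [W1, U1, h n (by omega), ih fun i hi => h i (by omega)]
  have UU : ∀ n, U n ∈ unitary A := fun n => by
    rw [← WU n 1 fun i _ => sfun_one i]; exact Wu n 1
  set an : ℕ → A := fun n => ∑ i ∈ Finset.range n, ((1 : ℝ) / 2) ^ (i + 1) • p i with han
  set bn : ℕ → A := fun n => ∑ i ∈ Finset.range n, ((1 : ℝ) / 2) ^ (i + 1) • q i with hbn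
  have hUa : ∀ n, U n * an n * star (U n) = bn n := by
    intro n
    simp only [han, hbn]
    rw [Finset.mul_sum, Finset.sum_mul]
    refine Finset.sum_congr rfl fun i hi => ?_
    rw [mul_smul_comm, smul_mul_assoc, Up n i (Finset.mem_range.1 hi)]
  have hgb : ∀ n t, g n t * bn n * star (g n t) = bn n := by
    intro n t
    have hc : Commute (bn n) (g n t) :=
      Commute.sum_left _ _ _ fun i hi => (gc n t i (Finset.mem_range.1 hi)).smul_left _
    rw [← hc.eq, mul_assoc, (Unitary.mem_iff.1 (g3 n t)).2, mul_one]
  have htail := tail_bound hp ha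
  let H : ℕ → ℝ → A := fun n t => W n t * a * star (W n t)
  have Hc : ∀ n, Continuous (H n) := fun n => ((Wc n).mul continuous_const).mul (Wc n).star
  have hdist : ∀ t n, dist (H n t) (H (n + 1) t) ≤ 4 / 2 / 2 ^ n := by
    intro t n
    by_cases hs : sfun n t = 0
    · have : H (n + 1) t = H n t := by
        simp only [H]; rw [W1, hs, g2, one_mul]
      rw [this, dist_self]; positivity
    · have hW := WU n t fun i hi => sfun_eq_one hs hi
      simp only [H]
      rw [W1, hW]
      set γ := g n (sfun n t) with hγ
      set X := U n * (a - an n) * star (U n) with hX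
      have e1 : U n * a * star (U n) = X + bn n := by
        rw [hX, mul_sub, sub_mul, hUa]; abel
      have e2 : γ * U n * a * star (γ * U n) = γ * X * star γ + bn n := by
        rw [star_mul]
        calc _ = γ * (U n * a * star (U n)) * star γ := by simp only [mul_assoc]
          _ = _ := by rw [e1, mul_add, add_mul, hgb]
      rw [e1, e2, dist_eq_norm, add_sub_add_right_eq_sub]
      have hXn : ‖X‖ ≤ 1 / 2 ^ n := (norm_conj_le (UU n)).trans (htail n)
      calc ‖X - γ * X * star γ‖ ≤ ‖X‖ + ‖γ * X * star γ‖ := norm_sub_le _ _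
        _ ≤ 1 / 2 ^ n + 1 / 2 ^ n := add_le_add hXn ((norm_conj_le (g3 _ _)).trans hXn)
        _ = 4 / 2 / 2 ^ n := by ring
  have hlim : ∀ t, ∃ y, Tendsto (fun n => H n t) atTop (𝓝 y) := fun t =>
    cauchySeq_tendsto_of_complete (cauchySeq_of_le_geometric_two (hdist t))
  choose h hh using hlim
  have hun : TendstoUniformly H h atTop := by
    rw [Metric.tendstoUniformly_iff]
    intro ε hε
    have h4 : Tendsto (fun n : ℕ => (4 : ℝ) / 2 ^ n) atTop (𝓝 0) := by
      have := (tendsto_pow_atTop_nhds_zero_of_lt_one (r := (1 : ℝ) / 2) (by norm_num)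
        (by norm_num)).const_mul 4
      rw [mul_zero] at this
      refine this.congr fun n => ?_
      rw [div_pow, one_pow]; ring
    filter_upwards [h4.eventually (gt_mem_nhds hε)] with n hn t
    rw [dist_comm]
    exact (dist_le_of_le_geometric_two_of_tendsto (hdist t) (hh t) n).trans_lt hn
  have hcont : Continuous h := hun.continuous (Frequently.of_forall Hc)
  have h1 : h 1 = b := by
    refine tendsto_nhds_unique (hh 1) ?_
    have : Tendsto (fun n => U n * (a - an n) * star (U n)) atTop (𝓝 0) := by
      refine squeeze_zero_norm (fun n => norm_conj_le (UU n)) ?_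
      have := (tendsto_const_nhds (x := a)).sub ha
      rw [sub_self] at this
      exact tendsto_zero_iff_norm_tendsto_zero.1 this
    have := this.add hb
    rw [zero_add] at this
    refine this.congr fun n => ?_
    simp only [H]
    rw [WU n 1 fun i _ => sfun_one i, mul_sub, sub_mul, hUa]
    abel
  have hpos : 0 ≤ a := sum_nonneg_proj hp ha
  choose v hv hv' using hmvn
  refine ⟨h, hcont.continuousOn, ?_, h1, fun t ht => ⟨?_, ?_⟩⟩
  · refine tendsto_nhds_unique (hh 0) (tendsto_const_nhds.congr fun n => ?_)
    have : W n 0 = 1 := by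
      induction n with
      | zero => rfl
      | succ n ih => rw [W1, sfun_zero, g2, ih, one_mul]
    simp [H, this]
  · exact ge_of_tendsto' (hh t) fun n => star_right_conjugate_nonneg hpos _
  · rcases ht.2.lt_or_eq with h' | rfl
    · obtain ⟨M, hM⟩ := sfun_eventually h'
      have hWM : ∀ n, M ≤ n → W n t = W M t := by
        intro n hn
        induction n, hn using Nat.le_induction with
        | base => rfl
        | succ n hn ih => rw [W1, hM n hn, g2, one_mul, ih]
      have hht : h t = W M t * a * star (W M t) := by
        refine tendsto_nhds_unique (hh t) (tendsto_const_nhds.congr' ?_)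
        filter_upwards [eventually_ge_atTop M] with n hn
        simp only [H]; rw [hWM n hn]
      have hu := Unitary.mem_iff.1 (Wu M t)
      refine ⟨⟨fun _ => W M t, by simp [hht]⟩, ⟨fun _ => star (W M t), ?_⟩⟩
      have : star (W M t) * h t * star (star (W M t)) = a := by
        rw [hht, star_star]
        calc _ = (star (W M t) * W M t) * a * (star (W M t) * W M t) := by simp only [mul_assoc]
          _ = a := by rw [hu.1, one_mul, mul_one]
      simp only [this, sub_self, norm_zero]
      exact tendsto_const_nhds
    · rw [h1]
      exact ⟨cuntz_le hp horthp hv hv' ha hb,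
        cuntz_le (v := fun i => star (v i)) hq horthq (fun i => by rw [star_star, hv'])
          (fun i => by rw [star_star, hv]) hb ha⟩
end

section
/- Let A be a unital simple separable approximately divisible stably finite C*-algebra. Let a, b ∈ A be nonzero positive elements such that 0 is not an accumulation point of the spectrum of a, 0 is not an accumulation point of the spectrum of b, and a is Cuntz equivalent to b. Then there is a norm-continuous map h : [0,1] → A such that h(0) = a, h(1) = b, h(t) is positive for every t ∈ [0,1], and h(t) is Cuntz equivalent to a for every t ∈ [0,1]. -/
open Filter Topology

section Helpers

variable {A : Type*} [CStarAlgebra A]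

lemma aux_cfc_cont {s : Set ℝ} (hs : IsOpen s) {f : ℝ → ℝ} (hf : ContinuousOn f s) :
    ContinuousOn (fun a : A => cfc f a) {a : A | IsSelfAdjoint a ∧ spectrum ℝ a ⊆ s} := by
  refine ContinuousOn.cfc_of_mem_nhdsSet (s := s) f ?_ continuousOn_id (fun x hx => hx.1) hf
  rw [hs.mem_nhdsSet]
  simp only [Set.iUnion_subset_iff]
  intro i hi
  exact hi.2

lemma aux_spec_bound {z : A} {x : ℝ} (hx : x ∈ spectrum ℝ z) : |x - 1| ≤ ‖z - 1‖ := by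
  have h : x - 1 ∈ spectrum ℝ (z - 1) := by
    have := spectrum.sub_singleton_eq (R := ℝ) z 1
    rw [map_one] at this
    rw [← this]
    exact Set.sub_mem_sub hx rfl
  rcases subsingleton_or_nontrivial A with hA | hA
  · rw [spectrum.of_subsingleton] at hx
    exact hx.elim
  · simpa using spectrum.norm_le_norm_of_mem h

/-- inverse square root near 1 -/
noncomputable def rhoFun (x : ℝ) : ℝ := (Real.sqrt (max x (1 / 2)))⁻¹

lemma rhoFun_cont : Continuous rhoFun := by
  unfold rhoFun
  refine Continuous.inv₀ (by fun_prop) (fun x => ?_)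
  have : 0 < max x (1 / 2) := lt_max_of_lt_right (by norm_num)
  positivity

/-- inverse square root near 1 -/
noncomputable def nrm (z : A) : A := cfc rhoFun z

lemma nrm_sa (z : A) : IsSelfAdjoint (nrm z) := cfc_predicate _ _

lemma nrm_comm {z c : A} (h : Commute z c) : Commute (nrm z) c := h.cfc_real _

lemma nrm_mul_of_spec {z : A} (hz : IsSelfAdjoint z) (h : ∀ x ∈ spectrum ℝ z, 1 / 2 ≤ x) :
    nrm z * z * nrm z = 1 := by
  have h1 : nrm z * z * nrm z = cfc (fun x => rhoFun x * x * rhoFun x) z := by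
    have hc := rhoFun_cont.continuousOn (s := spectrum ℝ z)
    rw [cfc_mul (fun x => rhoFun x * x) rhoFun z (by fun_prop) (by fun_prop),
      cfc_mul rhoFun (fun x => x) z (by fun_prop) (by fun_prop), cfc_id' ℝ z]
    rfl
  rw [h1, ← cfc_one ℝ z]
  refine cfc_congr (fun x hx => ?_)
  have hb := h x hx
  have : max x (1 / 2) = x := max_eq_left hb
  simp only [rhoFun, this, Pi.one_apply]
  have hx0 : 0 < x := by linarith
  have h2 := Real.mul_self_sqrt hx0.le
  have h3 : Real.sqrt x ≠ 0 := by positivity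
  field_simp
  nlinarith

lemma nrm_mul {z : A} (hz : IsSelfAdjoint z) (h : ‖z - 1‖ < 1 / 2) :
    nrm z * z * nrm z = 1 := by
  refine nrm_mul_of_spec hz fun x hx => ?_
  have hb := (aux_spec_bound hx).trans_lt h
  rw [abs_lt] at hb
  linarith

lemma nrm_one : nrm (1 : A) = 1 := by
  unfold nrm
  rw [← map_one (algebraMap ℝ A), cfc_algebraMap]
  have : max (1 : ℝ) (1 / 2) = 1 := by norm_num
  simp only [rhoFun, this]
  simp

lemma nrm_tendsto {ι : Type*} {l : Filter ι} {z : ι → A} (hz : ∀ i, IsSelfAdjoint (z i))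
    (h : Tendsto z l (𝓝 1)) : Tendsto (fun i => nrm (z i)) l (𝓝 1) := by
  have h1 := (aux_cfc_cont (A := A) isOpen_univ rhoFun_cont.continuousOn) 1
    ⟨IsSelfAdjoint.one A, Set.subset_univ _⟩
  have h2 : Tendsto z l (𝓝[{a : A | IsSelfAdjoint a ∧ spectrum ℝ a ⊆ Set.univ}] 1) :=
    tendsto_nhdsWithin_iff.2 ⟨h, Eventually.of_forall fun i => ⟨hz i, Set.subset_univ _⟩⟩
  have h3 := h1.tendsto.comp h2
  have h4 : cfc rhoFun (1 : A) = 1 := nrm_one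
  rw [h4] at h3
  exact h3

/-- spectral cutoff at one half -/
noncomputable def chiFun (x : ℝ) : ℝ := open Classical in if x < 1 / 2 then 0 else 1

lemma chiFun_cont : ContinuousOn chiFun {(1 / 2 : ℝ)}ᶜ := by
  intro x hx
  apply ContinuousAt.continuousWithinAt
  rcases lt_or_gt_of_ne hx with h | h
  · refine (continuousAt_const (y := (0 : ℝ))).congr ?_
    filter_upwards [Iio_mem_nhds h] with y hy
    simp only [chiFun, if_pos (Set.mem_Iio.1 hy)]
  · refine (continuousAt_const (y := (1 : ℝ))).congr ?_
    filter_upwards [Ioi_mem_nhds h] with y hy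
    simp only [chiFun, if_neg (not_lt.2 (Set.mem_Ioi.1 hy).le)]

/-- spectral cutoff at one half -/
noncomputable def chiP (z : A) : A := cfc chiFun z

lemma chiP_proj {z : A} (h : (1 / 2 : ℝ) ∉ spectrum ℝ z) : IsStarProjection (chiP z) := by
  refine ⟨?_, cfc_predicate _ _⟩
  have hc : ContinuousOn chiFun (spectrum ℝ z) := chiFun_cont.mono (by
    intro x hx hx'
    exact h (hx' ▸ hx))
  unfold chiP IsIdempotentElem
  rw [← cfc_mul chiFun chiFun z hc hc]
  congr 1
  ext x
  unfold chiFun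
  split_ifs <;> simp

lemma chiP_comm {z c : A} (h : Commute z c) : Commute (chiP z) c := h.cfc_real _

lemma half_not_mem {p x : A} (hp : IsStarProjection p) (h : ‖x - p‖ < 1 / 2) :
    (1 / 2 : ℝ) ∉ spectrum ℝ x := by
  rcases subsingleton_or_nontrivial A with hA | hA
  · rw [spectrum.of_subsingleton]; simp
  rw [spectrum.notMem_iff]
  have hpp := hp.isIdempotentElem.eq
  have hu : (1 - (2 : ℝ) • p) * (1 - (2 : ℝ) • p) = 1 := by
    simp only [mul_sub, sub_mul, mul_one, one_mul, smul_mul_smul_comm, hpp]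
    module
  have hus : star (1 - (2 : ℝ) • p) = 1 - (2 : ℝ) • p := by
    simp [hp.isSelfAdjoint.star_eq]
  set u := 1 - (2 : ℝ) • p with hudef
  have hun : ‖u‖ * ‖u‖ = 1 := by
    rw [← CStarRing.norm_star_mul_self, hus, hu, norm_one]
  have hun1 : ‖u‖ = 1 := by nlinarith [norm_nonneg u]
  have hU : IsUnit u := ⟨⟨u, u, hu, hu⟩, rfl⟩
  have hfac : algebraMap ℝ A (1 / 2) - x = ((1 / 2 : ℝ) • u) * (1 - (2 : ℝ) • (u * (x - p))) := by
    have : (1 / 2 : ℝ) • u * (1 - (2 : ℝ) • (u * (x - p)))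
        = (1 / 2 : ℝ) • u - (u * u) * (x - p) := by
      rw [mul_sub, mul_one, smul_mul_smul_comm, mul_assoc]; norm_num
    rw [this, hu, one_mul, hudef, Algebra.algebraMap_eq_smul_one]
    module
  rw [hfac]
  refine IsUnit.mul ?_ ?_
  · rw [Algebra.smul_def]; exact ((IsUnit.mk0 (1 / 2 : ℝ) (by norm_num)).map (algebraMap ℝ A)).mul hU
  · apply isUnit_one_sub_of_norm_lt_one
    calc ‖(2 : ℝ) • (u * (x - p))‖ = 2 * ‖u * (x - p)‖ := by rw [norm_smul]; norm_num
      _ ≤ 2 * (‖u‖ * ‖x - p‖) := by gcongr; exact norm_mul_le _ _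
      _ < 1 := by rw [hun1]; linarith

lemma chiP_self {p : A} (hp : IsStarProjection p) : chiP p = p := by
  unfold chiP
  conv_rhs => rw [← cfc_id' ℝ p hp.isSelfAdjoint]
  refine cfc_congr (fun x hx => ?_)
  have := hp.isIdempotentElem.spectrum_subset (𝕜 := ℝ) hx
  rcases this with h | h
  · subst h; simp [chiFun]
  · have : x = 1 := h
    subst this; norm_num [chiFun]

lemma chiP_tendsto {ι : Type*} {l : Filter ι} {z : ι → A} {p : A} (hp : IsStarProjection p)
    (hz : ∀ i, IsSelfAdjoint (z i)) (h : Tendsto z l (𝓝 p)) :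
    Tendsto (fun i => chiP (z i)) l (𝓝 p) ∧ ∀ᶠ i in l, IsStarProjection (chiP (z i)) := by
  have hev : ∀ᶠ i in l, (1 / 2 : ℝ) ∉ spectrum ℝ (z i) := by
    have := (tendsto_iff_norm_sub_tendsto_zero.1 h).eventually_lt_const
      (show (0 : ℝ) < 1 / 2 by norm_num)
    filter_upwards [this] with i hi using half_not_mem hp hi
  have hp2 : (1 / 2 : ℝ) ∉ spectrum ℝ p := half_not_mem hp (by simp)
  have hsub : ∀ {y : A}, (1 / 2 : ℝ) ∉ spectrum ℝ y → spectrum ℝ y ⊆ {(1 / 2 : ℝ)}ᶜ := by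
    intro y hy x hx hx'
    exact hy (hx' ▸ hx)
  refine ⟨?_, hev.mono fun i hi => chiP_proj hi⟩
  have h1 := (aux_cfc_cont (A := A) isOpen_compl_singleton chiFun_cont) p
    ⟨hp.isSelfAdjoint, hsub hp2⟩
  have h2 : Tendsto z l
      (𝓝[{a : A | IsSelfAdjoint a ∧ spectrum ℝ a ⊆ {(1 / 2 : ℝ)}ᶜ}] p) :=
    tendsto_nhdsWithin_iff.2 ⟨h, hev.mono fun i hi => ⟨hz i, hsub hi⟩⟩
  have h3 := h1.tendsto.comp h2
  have h4 : cfc chiFun p = p := chiP_self hp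
  rw [h4] at h3
  exact h3

lemma joined_of_close {p q : A} (hp : IsStarProjection p) (hq : IsStarProjection q)
    (h : ‖q - p‖ < 1 / 2) : JoinedIn {x : A | IsStarProjection x} p q := by
  let x : ℝ → A := fun t => p + t • (q - p)
  have hx : ∀ t ∈ Set.Icc (0 : ℝ) 1, IsSelfAdjoint (x t) ∧ spectrum ℝ (x t) ⊆ {(1 / 2 : ℝ)}ᶜ := by
    intro t ht
    refine ⟨hp.isSelfAdjoint.add 
      (IsSelfAdjoint.smul (IsSelfAdjoint.all t) (hq.isSelfAdjoint.sub hp.isSelfAdjoint)), ?_⟩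
    intro y hy hy'
    refine half_not_mem hp (x := x t) ?_ (hy' ▸ hy)
    simp only [x, add_sub_cancel_left, norm_smul, Real.norm_eq_abs, abs_of_nonneg ht.1]
    nlinarith [ht.2, norm_nonneg (q - p)]
  have hc : ContinuousOn (fun t => chiP (x t)) (Set.Icc 0 1) :=
    (aux_cfc_cont (A := A) isOpen_compl_singleton chiFun_cont).comp
      (show ContinuousOn x (Set.Icc 0 1) by fun_prop) hx
  refine JoinedIn.ofLine (f := fun t => chiP (x t)) hc ?_ ?_ ?_
  · simp [x, chiP_self hp]
  · simp [x, chiP_self hq]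
  · rintro _ ⟨t, ht, rfl⟩
    exact chiP_proj fun h => (hx t ht).2 h rfl

lemma cuntzLE_iff {a b : A} : CuntzLE a b ↔ ∀ ε > 0, ∃ v : A, ‖v * b * star v - a‖ < ε := by
  constructor
  · rintro ⟨v, hv⟩ ε hε
    obtain ⟨n, hn⟩ := (hv.eventually_lt_const hε).exists
    exact ⟨v n, hn⟩
  · intro h
    choose v hv using fun n : ℕ => h (1 / ((n : ℝ) + 1)) (by positivity)
    refine ⟨v, squeeze_zero (fun n => norm_nonneg _) (fun n => (hv n).le) ?_⟩
    exact tendsto_one_div_add_atTop_nhds_zero_nat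

lemma cuntzLE_of_eq {a b v : A} (h : v * b * star v = a) : CuntzLE a b :=
  cuntzLE_iff.2 fun ε hε => ⟨v, by rw [h]; simpa using hε⟩

lemma cuntzLE_trans {a b c : A} (h1 : CuntzLE a b) (h2 : CuntzLE b c) : CuntzLE a c := by
  rw [cuntzLE_iff] at *
  intro ε hε
  obtain ⟨v, hv⟩ := h1 (ε / 2) (by positivity)
  obtain ⟨w, hw⟩ := h2 (ε / 2 / (‖v‖ * ‖v‖ + 1)) (by positivity)
  refine ⟨v * w, ?_⟩
  have e : v * w * c * star (v * w) - a
      = v * (w * c * star w - b) * star v + (v * b * star v - a) := by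
    rw [star_mul]; noncomm_ring
  have hw' : ‖w * c * star w - b‖ * (‖v‖ * ‖v‖ + 1) < ε / 2 := by
    rwa [lt_div_iff₀ (by positivity)] at hw
  have h3 : ‖v * (w * c * star w - b) * star v‖ ≤ ‖v‖ * ‖w * c * star w - b‖ * ‖v‖ := by
    calc _ ≤ ‖v * (w * c * star w - b)‖ * ‖star v‖ := norm_mul_le _ _
      _ ≤ _ := by rw [norm_star]; gcongr; exact norm_mul_le _ _
  rw [e]
  calc _ ≤ _ := norm_add_le _ _
    _ < ε := by nlinarith [norm_nonneg (w * c * star w - b)]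

lemma cuntz_refl (a : A) : CuntzEquiv a a :=
  ⟨cuntzLE_of_eq (v := 1) (by simp), cuntzLE_of_eq (v := 1) (by simp)⟩

lemma cuntz_symm {a b : A} (h : CuntzEquiv a b) : CuntzEquiv b a := ⟨h.2, h.1⟩

lemma cuntz_trans {a b c : A} (h1 : CuntzEquiv a b) (h2 : CuntzEquiv b c) : CuntzEquiv a c :=
  ⟨cuntzLE_trans h1.1 h2.1, cuntzLE_trans h2.2 h1.2⟩

/-- If a projection `p` is approximately `w * star w`, `w = p * w`, correct `w`. -/
lemma polar_fix {p w : A} (hp : IsStarProjection p) (hw : p * w = w)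
    (h : ‖w * star w - p‖ < 1 / 2) :
    nrm (w * star w + (1 - p)) * w * star w * nrm (w * star w + (1 - p)) = p := by
  have hw' : star w * p = star w := by
    have := congrArg star hw; rwa [star_mul, hp.isSelfAdjoint.star_eq] at this
  have hpp := hp.isIdempotentElem.eq
  set z := w * star w + (1 - p) with hz
  have hzs : IsSelfAdjoint z :=
    (IsSelfAdjoint.mul_star_self w).add hp.one_sub.isSelfAdjoint
  have hz1 : ‖z - 1‖ < 1 / 2 := by
    have : z - 1 = w * star w - p := by rw [hz]; abel
    rwa [this]
  have hpz : p * z = w * star w := by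
    rw [hz, mul_add, ← mul_assoc, hw, mul_sub, mul_one, hpp]; simp
  have hzp : z * p = w * star w := by
    rw [hz, add_mul, mul_assoc, hw', sub_mul, one_mul, hpp]; simp
  have hcomm : Commute (nrm z) p := nrm_comm (show z * p = p * z by rw [hpz, hzp])
  calc nrm z * w * star w * nrm z = (nrm z * p) * z * nrm z := by
        rw [mul_assoc (nrm z) w, ← hpz]; noncomm_ring
    _ = p * (nrm z * z * nrm z) := by rw [hcomm.eq]; noncomm_ring
    _ = p := by rw [nrm_mul hzs hz1, mul_one]

lemma cuntzLE_of_close {p q : A} (hp : IsStarProjection p) (hq : IsStarProjection q)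
    (h : ‖q - p‖ < 1 / 2) : CuntzLE p q := by
  have hpp := hp.isIdempotentElem.eq
  have hqq := hq.isIdempotentElem.eq
  have hps := hp.isSelfAdjoint.star_eq
  have hqs := hq.isSelfAdjoint.star_eq
  have e1 : p * q * star (p * q) = p * q * p := by
    rw [star_mul, hps, hqs, mul_assoc p q, ← mul_assoc q q, hqq, mul_assoc]
  have hn : ‖p‖ ≤ 1 := hp.norm_le
  have h1 := polar_fix (w := p * q) hp (by rw [← mul_assoc, hpp]) (by
    have : p * q * star (p * q) - p = p * (q - p) * p := by
      rw [e1, mul_sub, sub_mul, hpp, hpp]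
    rw [this]
    calc _ ≤ ‖p‖ * ‖q - p‖ * ‖p‖ := by
          refine (norm_mul_le _ _).trans ?_
          gcongr; exact norm_mul_le _ _
      _ ≤ 1 * ‖q - p‖ * 1 := by gcongr
      _ < _ := by simpa using h)
  have hr := nrm_sa (p * q * star (p * q) + (1 - p))
  set r := nrm (p * q * star (p * q) + (1 - p))
  refine cuntzLE_of_eq (v := r * p) ?_
  rw [star_mul, hps, hr.star_eq]
  refine Eq.trans ?_ h1
  calc r * p * q * (p * r) = r * (p * q * p) * r := by noncomm_ring
    _ = _ := by rw [← e1]; noncomm_ring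

lemma joined_cuntz {p q : A} (h : JoinedIn {x : A | IsStarProjection x} p q) :
    JoinedIn {x : A | IsStarProjection x ∧ CuntzEquiv x p} p q := by
  obtain ⟨γ, hγ⟩ := h
  refine ⟨γ, fun t => ⟨hγ t, ?_⟩⟩
  have hlc : IsLocallyConstant (fun t => CuntzEquiv (γ t) p) := by
    rw [IsLocallyConstant.iff_eventually_eq]
    intro t
    have := (tendsto_iff_norm_sub_tendsto_zero.1 (γ.continuous.tendsto t)).eventually_lt_const
      (show (0 : ℝ) < 1 / 2 by norm_num)
    filter_upwards [this] with s hs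
    have h1 : CuntzEquiv (γ s) (γ t) :=
      ⟨cuntzLE_of_close (hγ s) (hγ t) (by rwa [norm_sub_rev]), cuntzLE_of_close (hγ t) (hγ s) hs⟩
    exact propext ⟨fun h => cuntz_trans (cuntz_symm h1) h, fun h => cuntz_trans h1 h⟩
  have := hlc.apply_eq_of_isPreconnected isPreconnected_univ (Set.mem_univ t)
    (Set.mem_univ (0 : unitInterval))
  simp only [Path.source] at this
  rw [this]
  exact cuntz_refl p

lemma finite_of_sf (hsf : StablyFinite A) {v : A} (h : star v * v = 1) : v * star v = 1 := by
  have := hsf 1 (Matrix.of fun _ _ => v) (by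
    ext i j
    fin_cases i; fin_cases j
    simpa [Matrix.mul_apply, Matrix.star_apply] using h)
  have h2 := congrFun (congrFun this 0) 0
  simpa [Matrix.mul_apply, Matrix.star_apply] using h2

lemma exists_partial {p q : A} (hp : IsStarProjection p) (hq : IsStarProjection q)
    (h : CuntzLE p q) : ∃ u : A, u * star u = p ∧ u * q = u := by
  have hpp := hp.isIdempotentElem.eq
  have hqq := hq.isIdempotentElem.eq
  have hps := hp.isSelfAdjoint.star_eq
  have hqs := hq.isSelfAdjoint.star_eq
  obtain ⟨v, hv⟩ := cuntzLE_iff.1 h (1 / 2) (by norm_num)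
  have e1 : p * v * q * star (p * v * q) = p * (v * q * star v) * p := by
    rw [star_mul, star_mul, hps, hqs]
    calc _ = p * v * (q * q) * star v * p := by noncomm_ring
      _ = _ := by rw [hqq]; noncomm_ring
  have hn : ‖p‖ ≤ 1 := hp.norm_le
  have h1 := polar_fix (w := p * v * q) hp (by rw [← mul_assoc, ← mul_assoc, hpp]) (by
    have : p * v * q * star (p * v * q) - p = p * (v * q * star v - p) * p := by
      rw [e1, mul_sub, sub_mul, hpp, hpp]
    rw [this]
    calc _ ≤ ‖p‖ * ‖v * q * star v - p‖ * ‖p‖ := by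
          refine (norm_mul_le _ _).trans ?_
          gcongr; exact norm_mul_le _ _
      _ ≤ 1 * ‖v * q * star v - p‖ * 1 := by gcongr
      _ < _ := by simpa using hv)
  have hr := nrm_sa (p * v * q * star (p * v * q) + (1 - p))
  set r := nrm (p * v * q * star (p * v * q) + (1 - p))
  refine ⟨r * (p * v * q), ?_, ?_⟩
  · rw [star_mul, hr.star_eq]; conv_rhs => rw [← h1]
    noncomm_ring
  · rw [mul_assoc, mul_assoc _ q q, hqq]

lemma star_fix {u p : A} (hp : IsStarProjection p) (h : u * star u = p) : p * u = u := by
  have hpp := hp.isIdempotentElem.eq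
  have : (p * u - u) * star (p * u - u) = 0 := by
    rw [star_sub, star_mul, hp.isSelfAdjoint.star_eq]
    calc _ = p * (u * star u) * p - p * (u * star u) - (u * star u) * p + u * star u := by
          noncomm_ring
      _ = 0 := by rw [h, hpp, hpp]; simp
  rw [CStarRing.mul_star_self_eq_zero_iff] at this
  exact sub_eq_zero.1 this

lemma mvn_of_cuntz (hsf : StablyFinite A) {p q : A} (hp : IsStarProjection p)
    (hq : IsStarProjection q) (h : CuntzEquiv p q) :
    ∃ v : A, star v * v = p ∧ v * star v = q := by
  obtain ⟨u, hu, hu1⟩ := exists_partial hp hq h.1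
  obtain ⟨w, hw, hw1⟩ := exists_partial hq hp h.2
  have hpu := star_fix hp hu
  have hqw := star_fix hq hw
  have hqq := hq.isIdempotentElem.eq
  have hqs := hq.isSelfAdjoint.star_eq
  have hus : q * star u = star u := by
    have := congrArg star hu1; rwa [star_mul, hqs] at this
  -- y = w * u
  have hyy : (w * u) * star (w * u) = q := by
    rw [star_mul]
    calc _ = w * (u * star u) * star w := by noncomm_ring
      _ = q := by rw [hu, hw1, hw]
  have hyq : (w * u) * q = w * u := by rw [mul_assoc, hu1]
  have hqy : q * (w * u) = w * u := by rw [← mul_assoc, hqw]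
  have hsy : star (w * u) * q = star (w * u) := by
    have := congrArg star hqy; rwa [star_mul, hqs] at this
  have hsy' : q * star (w * u) = star (w * u) := by
    have := congrArg star hyq; rwa [star_mul, hqs] at this
  set y := w * u with hy
  have hfin := finite_of_sf hsf (v := star y + (1 - q)) (by
    rw [star_add, star_star, star_sub, star_one, hqs]
    calc _ = y * star y + (y - y * q) + (star y - q * star y) + (1 - q - q + q * q) := by
          noncomm_ring
      _ = 1 := by rw [hyy, hyq, hsy', hqq]; abel)
  have hyy' : star y * y = q := by
    have e : (star y + (1 - q)) * star (star y + (1 - q)) = star y * y + (1 - q) := by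
      rw [star_add, star_star, star_sub, star_one, hqs]
      calc _ = star y * y + (y - q * y) + (star y - star y * q) + (1 - q - q + q * q) := by
            noncomm_ring
        _ = _ := by rw [hqy, hsy, hqq]; abel
    rw [e] at hfin
    have := sub_eq_zero.2 hfin
    rw [← sub_eq_zero, ← this]; abel
  have hyu : y * (star u * u) = y := by
    rw [hy]
    calc _ = w * (u * star u * u) := by noncomm_ring
      _ = _ := by rw [hu, hpu]
  have hqu : q * (star u * u) = q := by
    rw [← hyy', mul_assoc, hyu]
  refine ⟨star u, by rwa [star_star], ?_⟩
  rw [star_star, ← hqu, ← mul_assoc, hus]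

/-- finite sums of elements `a * d * b` -/
def idealGrp (d : A) : AddSubgroup A where
  carrier := {x | ∃ (K : ℕ) (a b : Fin K → A), x = ∑ i, a i * d * b i}
  zero_mem' := ⟨0, fun _ => 0, fun _ => 0, by simp⟩
  add_mem' := by
    rintro x y ⟨K, a, b, rfl⟩ ⟨L, a', b', rfl⟩
    exact ⟨K + L, Fin.append a a', Fin.append b b', by simp [Fin.sum_univ_add]⟩
  neg_mem' := by
    rintro x ⟨K, a, b, rfl⟩
    exact ⟨K, fun i => - a i, b, by simp⟩

lemma idealGrp_left {d x : A} (y : A) (h : x ∈ idealGrp d) : y * x ∈ idealGrp d := by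
  obtain ⟨K, a, b, rfl⟩ := h
  exact ⟨K, fun i => y * a i, b, by simp [Finset.mul_sum, mul_assoc]⟩

lemma idealGrp_right {d x : A} (y : A) (h : x ∈ idealGrp d) : x * y ∈ idealGrp d := by
  obtain ⟨K, a, b, rfl⟩ := h
  exact ⟨K, a, fun i => b i * y, by simp [Finset.sum_mul, mul_assoc]⟩

lemma simple_full (hs : IsSimpleCStarAlgebra A) {d : A} (hd : IsStarProjection d) (hd0 : d ≠ 0) :
    ∃ (K : ℕ) (s : Fin K → A), (∀ i, d * s i = s i) ∧ ∑ i, star (s i) * s i = 1 := by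
  have hdd := hd.isIdempotentElem.eq
  have hds := hd.isSelfAdjoint.star_eq
  let G := (idealGrp d).topologicalClosure
  have hG : (G : Set A) = closure (idealGrp d : Set A) := rfl
  let I : TwoSidedIdeal A := TwoSidedIdeal.mk' (G : Set A) G.zero_mem
    (fun h1 h2 => G.add_mem h1 h2) (fun h => G.neg_mem h)
    (fun {x y} h => map_mem_closure (f := fun z => x * z) (by fun_prop) h
      (fun z hz => idealGrp_left x hz))
    (fun {x y} h => map_mem_closure (f := fun z => z * y) (by fun_prop) h
      (fun z hz => idealGrp_right y hz))
  have hIG : (I : Set A) = G := TwoSidedIdeal.coe_mk' _ _ _ _ _ _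
  have hdI : d ∈ (I : Set A) := by
    rw [hIG, hG]
    exact subset_closure ⟨1, fun _ => 1, fun _ => 1, by simp⟩
  have h1G : (1 : A) ∈ closure (idealGrp d : Set A) := by
    rcases hs I (by rw [hIG]; exact isClosed_closure) with h | h
    · rw [h] at hdI
      exact (hd0 ((TwoSidedIdeal.mem_bot A).1 hdI)).elim
    · have : (1 : A) ∈ (I : Set A) := by rw [h]; trivial
      rwa [hIG] at this
  obtain ⟨y, hy, hy1⟩ := Metric.mem_closure_iff.1 h1G 1 one_pos
  have hyu : IsUnit y := by
    have := isUnit_one_sub_of_norm_lt_one (x := 1 - y) (by rwa [← dist_eq_norm])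
    simpa using this
  obtain ⟨u, rfl⟩ := hyu
  have h1 : (1 : A) ∈ idealGrp d := by
    have := idealGrp_left (↑u⁻¹ : A) hy
    rwa [Units.inv_mul] at this
  obtain ⟨K, a, b, hab⟩ := h1
  let s : Fin K → A := fun i => d * (b i + star (a i))
  have hT : ∑ i, star (s i) * s i
      = 2 + (∑ i, star (d * b i) * (d * b i) + ∑ i, star (d * star (a i)) * (d * star (a i))) := by
    have hab' : (1 : A) = ∑ i, star (b i) * d * star (a i) := by
      have := congrArg star hab
      simpa [hds, mul_assoc] using this
    have : (2 : A) = ∑ i, a i * d * b i + ∑ i, star (b i) * d * star (a i) := by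
      rw [← hab, ← hab']; norm_num
    rw [this, ← Finset.sum_add_distrib, ← Finset.sum_add_distrib, ← Finset.sum_add_distrib]
    refine Finset.sum_congr rfl fun i _ => ?_
    have e : ∀ x y : A, star (d * x) * (d * y) = star x * d * y := by
      intro x y
      rw [star_mul, hds, mul_assoc, ← mul_assoc d d, hdd, mul_assoc]
    simp only [s, e, star_add, star_star]
    noncomm_ring
  let _ := CStarAlgebra.spectralOrder A
  have _ := CStarAlgebra.spectralOrderedRing A
  set T := ∑ i, star (s i) * s i with hTdef
  have hTs : IsSelfAdjoint T := by
    rw [hTdef]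
    exact isSelfAdjoint_sum _ fun i _ => IsSelfAdjoint.star_mul_self _
  have h2T : algebraMap ℝ A 2 ≤ T := by
    rw [hT, map_ofNat]
    refine le_add_of_nonneg_right (add_nonneg ?_ ?_) <;>
    exact Finset.sum_nonneg fun i _ => star_mul_self_nonneg _
  have hsp := (algebraMap_le_iff_le_spectrum hTs).1 h2T
  have hn := nrm_mul_of_spec hTs fun x hx => by linarith [hsp x hx]
  refine ⟨K, fun i => s i * nrm T, fun i => ?_, ?_⟩
  · simp only [s, ← mul_assoc, hdd]
  · rw [← hn, hTdef, Finset.mul_sum, Finset.sum_mul]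
    refine Finset.sum_congr rfl fun i _ => ?_
    rw [star_mul, (nrm_sa _).star_eq]
    noncomm_ring

lemma rot_joined {x p f R : A} (hp : IsStarProjection p) (hR : IsStarProjection R)
    (hx : star x * x = p) (hf : x * star x = f) (hpx : p * x = 0) (hRp : R * p = 0)
    (hRx : R * x = 0) : JoinedIn {x : A | IsStarProjection x} (p + R) (f + R) := by
  have hpp := hp.isIdempotentElem.eq
  have hps := hp.isSelfAdjoint.star_eq
  have hxp : x * p = x := by
    have := star_fix (u := star x) hp (by rwa [star_star])
    have := congrArg star this
    rwa [star_mul, star_star, hps] at this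
  have hsx : star x * p = 0 := by
    have := congrArg star hpx; rwa [star_mul, hps, star_zero] at this
  let y : ℝ → A := fun t => Real.cos (Real.pi / 2 * t) • p + Real.sin (Real.pi / 2 * t) • x
  have hsy : ∀ t, star (y t)
      = Real.cos (Real.pi / 2 * t) • p + Real.sin (Real.pi / 2 * t) • star x := by
    intro t; simp [y, hps]
  have hyy : ∀ t, star (y t) * y t = p := by
    intro t
    rw [hsy]
    simp only [y, mul_add, add_mul, smul_mul_smul_comm, hpp, hpx, hsx, hx, smul_zero, add_zero,
      zero_add, ← add_smul]
    rw [← sq, ← sq, Real.cos_sq_add_sin_sq, one_smul]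
  have hyp : ∀ t, y t * p = y t := by
    intro t; simp only [y, add_mul, smul_mul_assoc, hpp, hxp]
  have hRy : ∀ t, R * y t = 0 := by
    intro t; simp only [y, mul_add, mul_smul_comm, hRp, hRx, smul_zero, add_zero]
  refine JoinedIn.ofLine (f := fun t => y t * star (y t) + R) ?_ ?_ ?_ ?_
  · apply Continuous.continuousOn
    simp only [hsy]
    fun_prop
  · simp [y, hpp, hps]
  · simp [y, hf]
  · rintro _ ⟨t, -, rfl⟩
    have h1 : IsStarProjection (y t * star (y t)) := by
      refine ⟨?_, IsSelfAdjoint.mul_star_self _⟩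
      show y t * star (y t) * (y t * star (y t)) = _
      calc _ = y t * (star (y t) * y t) * star (y t) := by noncomm_ring
        _ = _ := by rw [hyy, hyp]
    show IsStarProjection (y t * star (y t) + R)
    rw [add_comm]
    exact hR.add h1 (by rw [← mul_assoc, hRy, zero_mul])

lemma move_joined {c X R p q v : A} (hc : IsStarProjection c) (hR : IsStarProjection R)
    (hp : IsStarProjection p) (hq : IsStarProjection q)
    (hX : star X * X = c) (hcX : c * X = 0) (hRX : R * X = 0) (hRc : R * c = 0)
    (hv1 : star v * v = p) (hv2 : v * star v = q) (hcv : Commute c v) :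
    JoinedIn {x : A | IsStarProjection x} (p * c + R) (q * c + R) := by
  have hcs : Commute c (star v) := by
    have := congrArg star (hcv.eq)
    rw [star_mul, star_mul, hc.isSelfAdjoint.star_eq] at this
    exact this.symm
  have hcp : Commute c p := hv1 ▸ hcs.mul_right hcv
  have hcq : Commute c q := hv2 ▸ hcv.mul_right hcs
  have hpp := hp.isIdempotentElem.eq
  have hps := hp.isSelfAdjoint.star_eq
  have h1 := rot_joined (x := X * p) (p := p * c) (f := X * p * star X) (R := R)
    (hp.mul hc hcp.symm) hR (by
      rw [star_mul, hps]
      calc _ = p * (star X * X) * p := by noncomm_ring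
        _ = p * c := by rw [hX, mul_assoc, hcp.eq, ← mul_assoc, hpp])
    (by
      rw [star_mul, hps]
      calc _ = X * (p * p) * star X := by noncomm_ring
        _ = _ := by rw [hpp])
    (by rw [mul_assoc, ← mul_assoc c, hcX, zero_mul, mul_zero])
    (by rw [← hcp.eq, ← mul_assoc, hRc, zero_mul])
    (by rw [← mul_assoc, hRX, zero_mul])
  have h2 := rot_joined (x := X * star v) (p := q * c) (f := X * p * star X) (R := R)
    (hq.mul hc hcq.symm) hR (by
      rw [star_mul, star_star]
      calc _ = v * (star X * X) * star v := by noncomm_ring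
        _ = q * c := by rw [hX, mul_assoc, hcs.eq, ← mul_assoc, hv2])
    (by
      rw [star_mul, star_star]
      calc _ = X * (star v * v) * star X := by noncomm_ring
        _ = _ := by rw [hv1])
    (by rw [mul_assoc, ← mul_assoc c, hcX, zero_mul, mul_zero])
    (by rw [← hcq.eq, ← mul_assoc, hRc, zero_mul])
    (by rw [← mul_assoc, hRX, zero_mul])
  exact h1.trans h2.symm

section Block

variable {ι : Type*} [Fintype ι] [DecidableEq ι] {e : ι → ι → A}

lemma diag_proj (hmul : ∀ i j k l, e i j * e k l = if j = k then e i l else 0)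
    (hstar : ∀ i j, star (e i j) = e j i) {g : ι → A} (hg : ∀ j, IsStarProjection (g j))
    (hge : ∀ k i j, Commute (e i j) (g k)) (S : Finset ι) :
    IsStarProjection (∑ k ∈ S, g k * e k k) := by
  have he : ∀ k, IsStarProjection (e k k) := fun k => ⟨by
    show e k k * e k k = e k k
    simp [hmul], hstar k k⟩
  induction S using Finset.induction_on with
  | empty => simp [IsStarProjection.zero]
  | insert j S hj ih =>
    rw [Finset.sum_insert hj]
    refine ((hg j).mul (he j) (hge j j j).symm).add ih ?_
    rw [Finset.mul_sum]
    refine Finset.sum_eq_zero fun k hk => ?_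
    have hjk : j ≠ k := fun h => hj (h ▸ hk)
    calc g j * e j j * (g k * e k k) = g j * (e j j * g k) * e k k := by noncomm_ring
      _ = g j * g k * (e j j * e k k) := by rw [(hge k j j).eq]; noncomm_ring
      _ = 0 := by simp [hmul, hjk]

lemma flip_joined (hmul : ∀ i j k l, e i j * e k l = if j = k then e i l else 0)
    (hstar : ∀ i j, star (e i j) = e j i) {g : ι → A} (hg : ∀ j, IsStarProjection (g j))
    (hge : ∀ k i j, Commute (e i j) (g k)) {R : A} (hR : IsStarProjection R)
    (hRe : ∀ i j, R * e i j = 0) {K : ℕ} {L : Fin K → ι} (hL : Function.Injective L)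
    {j : ι} (hj : ∀ i, L i ≠ j) {s : Fin K → A} (hs : ∀ i, g (L i) * s i = 0)
    (hs1 : ∑ i, star (s i) * s i = 1) (hse : ∀ k i j, Commute (e i j) (s k))
    {v q : A} (hv1 : star v * v = g j) (hv2 : v * star v = q) (hve : ∀ i j, Commute (e i j) v)
    (hq : IsStarProjection q) :
    JoinedIn {x : A | IsStarProjection x} (∑ k, g k * e k k + R)
      (∑ k, Function.update g j q k * e k k + R) := by
  have he : ∀ k, IsStarProjection (e k k) := fun k => ⟨by
    show e k k * e k k = e k k
    simp [hmul], hstar k k⟩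
  have hsse : ∀ k i j, Commute (e i j) (star (s k)) := by
    intro k i j
    have := congrArg star ((hse k j i).eq)
    rw [star_mul, star_mul, hstar] at this
    exact this.symm
  let D := ∑ k ∈ Finset.univ.erase j, g k * e k k
  have hD : IsStarProjection D := diag_proj hmul hstar hg hge _
  have hRg : ∀ k, R * (g k * e k k) = 0 := by
    intro k
    rw [← (hge k k k).eq, ← mul_assoc, hRe, zero_mul]
  have hRD : R * D = 0 := by
    simp only [D, Finset.mul_sum, hRg, Finset.sum_const_zero]
  let X := ∑ i, s i * e (L i) j
  have key := move_joined (c := e j j) (X := X) (R := R + D) (p := g j) (q := q) (v := v)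
    (he j) (hR.add hD hRD) (hg j) hq ?_ ?_ ?_ ?_ hv1 hv2 (hve j j)
  · have e1 : ∑ k, g k * e k k + R = g j * e j j + (R + D) := by
      rw [← Finset.add_sum_erase _ _ (Finset.mem_univ j)]
      simp only [D]; abel
    have e2 : ∑ k, Function.update g j q k * e k k + R = q * e j j + (R + D) := by
      rw [← Finset.add_sum_erase _ _ (Finset.mem_univ j)]
      have : ∑ k ∈ Finset.univ.erase j, Function.update g j q k * e k k = D := by
        refine Finset.sum_congr rfl fun k hk => ?_
        rw [Function.update_of_ne (Finset.ne_of_mem_erase hk)]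
      rw [this, Function.update_self]
      abel
    rw [e1, e2]
    exact key
  · have : ∀ i i', star (s i * e (L i) j) * (s i' * e (L i') j)
        = if i = i' then star (s i) * s i * e j j else 0 := by
      intro i i'
      rw [star_mul, hstar]
      calc _ = e j (L i) * (star (s i) * s i') * e (L i') j := by noncomm_ring
        _ = (star (s i) * s i') * (e j (L i) * e (L i') j) := by
          rw [((hsse i j (L i)).mul_right (hse i' j (L i))).eq]; noncomm_ring
        _ = _ := by
          rw [hmul]
          by_cases h : i = i'
          · subst h; simp
          · simp [h, hL.ne h]
    simp only [X, star_sum, Finset.sum_mul, Finset.mul_sum, this]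
    simp only [Finset.sum_ite_eq', Finset.mem_univ, if_true]
    rw [← Finset.sum_mul, hs1, one_mul]
  · simp only [X, Finset.mul_sum]
    refine Finset.sum_eq_zero fun i _ => ?_
    rw [← mul_assoc, (hse i j j).eq, mul_assoc, hmul, if_neg (hj i).symm, mul_zero]
  · simp only [X, Finset.mul_sum]
    refine Finset.sum_eq_zero fun i _ => ?_
    rw [add_mul, ← (hse i (L i) j).eq, ← mul_assoc, hRe, zero_mul, zero_add]
    simp only [D, Finset.sum_mul]
    refine Finset.sum_eq_zero fun k _ => ?_
    calc g k * e k k * (e (L i) j * s i) = g k * ((e k k * e (L i) j) * s i) := by noncomm_ring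
      _ = 0 := by
        rw [hmul]
        split_ifs with h
        · rw [h, (hse i (L i) j).eq, ← mul_assoc, hs, zero_mul]
        · simp
  · rw [add_mul, hRe, zero_add]
    simp only [D, Finset.sum_mul]
    refine Finset.sum_eq_zero fun k hk => ?_
    rw [mul_assoc, hmul, if_neg (Finset.ne_of_mem_erase hk), mul_zero]

lemma phase_joined (hmul : ∀ i j k l, e i j * e k l = if j = k then e i l else 0)
    (hstar : ∀ i j, star (e i j) = e j i) {g : ι → A} (hg : ∀ j, IsStarProjection (g j))
    (hge : ∀ k i j, Commute (e i j) (g k)) {R : A} (hR : IsStarProjection R)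
    (hRe : ∀ i j, R * e i j = 0) {K : ℕ} {L : Fin K → ι} (hL : Function.Injective L)
    {s : Fin K → A} (hs : ∀ i, g (L i) * s i = 0)
    (hs1 : ∑ i, star (s i) * s i = 1) (hse : ∀ k i j, Commute (e i j) (s k))
    {v p q : A} (hv1 : star v * v = p) (hv2 : v * star v = q) (hve : ∀ i j, Commute (e i j) v)
    (hq : IsStarProjection q) (hqe : ∀ i j, Commute (e i j) q) (T : Finset ι)
    (hT : ∀ j ∈ T, g j = p) (hTL : ∀ i, L i ∉ T) :
    JoinedIn {x : A | IsStarProjection x} (∑ k, g k * e k k + R)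
      (∑ k, (if k ∈ T then q else g k) * e k k + R) := by
  induction T using Finset.induction_on with
  | empty =>
    simp only [Finset.notMem_empty, if_false]
    refine JoinedIn.refl ?_
    show IsStarProjection _
    rw [add_comm]
    refine hR.add (diag_proj hmul hstar hg hge _) ?_
    rw [Finset.mul_sum]
    refine Finset.sum_eq_zero fun k _ => ?_
    rw [← (hge k k k).eq, ← mul_assoc, hRe, zero_mul]
  | insert j T hj ih =>
    refine (ih (fun i hi => hT i (Finset.mem_insert_of_mem hi))
      (fun i hi => hTL i (Finset.mem_insert_of_mem hi))).trans ?_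
    have := flip_joined (g := fun k => if k ∈ T then q else g k) hmul hstar
      (by intro k; split_ifs; exacts [hq, hg k])
      (by intro k a b; split_ifs; exacts [hqe a b, hge k a b]) hR hRe hL (j := j)
      (fun i hi => hTL i (by rw [hi]; exact Finset.mem_insert_self _ _)) (s := s)
      (by
        intro i
        have : L i ∉ T := fun hi => hTL i (Finset.mem_insert_of_mem hi)
        simp only [this, if_false, hs])
      hs1 hse (v := v) (q := q)
      (by simp only [hj, if_false]; rw [hv1, hT j (Finset.mem_insert_self _ _)]) hv2 hve hq
    convert this using 4 with k
    by_cases hk : k = j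
    · subst hk; simp
    · simp [hk, Finset.mem_insert]

lemma block_joined (hmul : ∀ i j k l, e i j * e k l = if j = k then e i l else 0)
    (hstar : ∀ i j, star (e i j) = e j i) {p q v : A} (hp : IsStarProjection p)
    (hq : IsStarProjection q) (hpe : ∀ i j, Commute (e i j) p) (hqe : ∀ i j, Commute (e i j) q)
    (hve : ∀ i j, Commute (e i j) v) (hv1 : star v * v = p) (hv2 : v * star v = q)
    {R : A} (hR : IsStarProjection R) (hRe : ∀ i j, R * e i j = 0)
    {K₁ K₂ : ℕ} {s : Fin K₁ → A} {t : Fin K₂ → A}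
    (hs : ∀ i, p * s i = 0) (hs1 : ∑ i, star (s i) * s i = 1)
    (hse : ∀ k i j, Commute (e i j) (s k))
    (ht : ∀ i, q * t i = 0) (ht1 : ∑ i, star (t i) * t i = 1)
    (hte : ∀ k i j, Commute (e i j) (t k))
    (L : Fin K₁ ⊕ Fin K₂ → ι) (hL : Function.Injective L) :
    JoinedIn {x : A | IsStarProjection x} (p * (∑ k, e k k) + R) (q * (∑ k, e k k) + R) := by
  classical
  have h1 := phase_joined (g := fun _ => p) hmul hstar (fun _ => hp) (fun _ => hpe) hR hRe
    (L := fun i => L (Sum.inl i)) (fun a b h => Sum.inl_injective (hL h)) hs hs1 hse hv1 hv2 hve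
    hq hqe (Finset.univ.filter fun k => ∀ i, L (Sum.inl i) ≠ k) (fun _ _ => rfl) (by simp)
  have h2 := phase_joined (g := fun k => if k ∈ (Finset.univ.filter fun k => ∀ i, L (Sum.inl i) ≠ k)
      then q else p) hmul hstar (by intro k; split_ifs; exacts [hq, hp])
    (by intro k a b; split_ifs; exacts [hqe a b, hpe a b]) hR hRe
    (L := fun i => L (Sum.inr i)) (fun a b h => Sum.inr_injective (hL h)) (s := t)
    (by
      intro i
      rw [if_pos, ht]
      simp only [Finset.mem_filter, Finset.mem_univ, true_and]
      intro a h
      exact absurd (hL h) (by simp)) ht1 hte hv1 hv2 hve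
    hq hqe (Finset.univ.filter fun k => ∃ i, L (Sum.inl i) = k)
    (by
      intro j hj
      simp only [Finset.mem_filter, Finset.mem_univ, true_and] at hj ⊢
      obtain ⟨i, hi⟩ := hj
      rw [if_neg]
      push Not
      exact ⟨i, hi⟩)
    (by
      intro i
      simp only [Finset.mem_filter, Finset.mem_univ, true_and]
      rintro ⟨a, h⟩
      exact absurd (hL h) (by simp))
  have h3 := h1.trans h2
  rw [Finset.mul_sum, Finset.mul_sum]
  convert h3 using 4 with k
  simp only [Finset.mem_filter, Finset.mem_univ, true_and]
  split_ifs with h h'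
  · rfl
  · rfl
  · push Not at h'
    exact absurd h' h

end Block

section Approx

lemma unit_norm {ι : Type*} [DecidableEq ι] {e : ι → ι → A}
    (hmul : ∀ i j k l, e i j * e k l = if j = k then e i l else 0)
    (hstar : ∀ i j, star (e i j) = e j i) (i j : ι) : ‖e i j‖ ≤ 1 := by
  have h : IsStarProjection (e j j) := ⟨by
    show e j j * e j j = e j j
    simp [hmul], hstar j j⟩
  have h1 : ‖e i j‖ * ‖e i j‖ = ‖e j j‖ := by
    rw [← CStarRing.norm_star_mul_self, hstar, hmul, if_pos rfl]
  have := h.norm_le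
  nlinarith [norm_nonneg (e i j)]

lemma avg_comm {ι : Type*} [Fintype ι] [DecidableEq ι] {e : ι → ι → A}
    (hmul : ∀ i j k l, e i j * e k l = if j = k then e i l else 0) (o : ι) (c : A) (k l : ι) :
    Commute (e k l) (∑ i, e i o * c * e o i) := by
  show _ * _ = _ * _
  rw [Finset.mul_sum, Finset.sum_mul]
  have h1 : ∀ i, e k l * (e i o * c * e o i) = if l = i then e k o * c * e o i else 0 := by
    intro i
    rw [← mul_assoc, ← mul_assoc, hmul]
    split_ifs <;> simp
  have h2 : ∀ i, e i o * c * e o i * e k l = if i = k then e i o * c * e o l else 0 := by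
    intro i
    rw [mul_assoc, hmul]
    split_ifs <;> simp
  simp [h1, h2]

lemma avg_zero {ι κ : Type*} [Fintype ι] {e : ι → ι → A} {f : κ → κ → A}
    (h : ∀ i j k l, e i j * f k l = 0) (h' : ∀ i j k l, f k l * e i j = 0) (o : ι) (c : A)
    (k l : κ) : Commute (f k l) (∑ i, e i o * c * e o i) := by
  show _ * _ = _ * _
  rw [Finset.mul_sum, Finset.sum_mul]
  have h1 : ∀ i, f k l * (e i o * c * e o i) = 0 := by
    intro i
    rw [← mul_assoc, ← mul_assoc, h']; simp
  have h2 : ∀ i, e i o * c * e o i * f k l = 0 := by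
    intro i
    rw [mul_assoc, h]; simp
  simp [h1, h2]

lemma avg_tendsto {ι : Type*} [Fintype ι] [DecidableEq ι] {e : ℕ → ι → ι → A}
    (hmul : ∀ n i j k l, e n i j * e n k l = if j = k then e n i l else 0)
    (hstar : ∀ n i j, star (e n i j) = e n j i)
    (hc : ∀ i j c, Tendsto (fun n => ‖e n i j * c - c * e n i j‖) atTop (𝓝 0)) (o : ι) (c : A) :
    Tendsto (fun n => ∑ i, e n i o * c * e n o i - (∑ i, e n i i) * c) atTop (𝓝 0) := by
  have h1 : ∀ n, ∑ i, e n i o * c * e n o i - (∑ i, e n i i) * c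
      = ∑ i, e n i o * (c * e n o i - e n o i * c) := by
    intro n
    rw [Finset.sum_mul, ← Finset.sum_sub_distrib]
    refine Finset.sum_congr rfl fun i _ => ?_
    rw [mul_sub, ← mul_assoc, ← mul_assoc, hmul, if_pos rfl]
  simp only [h1]
  rw [← Finset.sum_const_zero (s := (Finset.univ : Finset ι))]
  refine tendsto_finsetSum _ fun i _ => ?_
  refine squeeze_zero_norm (fun n => ?_) (hc o i c)
  calc _ ≤ ‖e n i o‖ * ‖c * e n o i - e n o i * c‖ := norm_mul_le _ _
    _ ≤ 1 * ‖c * e n o i - e n o i * c‖ := by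
      gcongr; exact unit_norm (hmul n) (hstar n) i o
    _ = _ := by rw [one_mul, norm_sub_rev]

lemma approx_units (hdiv : ApproximatelyDivisible A) {N : ℕ} (hN : 0 < N) :
    ∃ (e : ℕ → Fin N → Fin N → A) (f : ℕ → Fin (N + 1) → Fin (N + 1) → A) (E : ℕ → A → A),
      (∀ n i j k l, e n i j * e n k l = if j = k then e n i l else 0) ∧
      (∀ n i j, star (e n i j) = e n j i) ∧
      (∀ n i j k l, f n i j * f n k l = if j = k then f n i l else 0) ∧
      (∀ n i j, star (f n i j) = f n j i) ∧
      (∀ n i j k l, e n i j * f n k l = 0) ∧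
      (∀ n i j k l, f n i j * e n k l = 0) ∧
      (∀ n, ∑ i, e n i i + ∑ i, f n i i = 1) ∧
      (∀ n c i j, Commute (e n i j) (E n c)) ∧
      (∀ n c i j, Commute (f n i j) (E n c)) ∧
      (∀ n c, star (E n c) = E n (star c)) ∧
      ∀ c, Tendsto (fun n => E n c) atTop (𝓝 c) := by
  obtain ⟨φ, hφ⟩ := hdiv N hN
  let e : ℕ → Fin N → Fin N → A := fun n i j => φ n (Matrix.single i j 1, 0)
  let f : ℕ → Fin (N + 1) → Fin (N + 1) → A := fun n i j => φ n (0, Matrix.single i j 1)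
  have h1 : ∀ n i j k l, e n i j * e n k l = if j = k then e n i l else 0 := by
    intro n i j k l
    simp only [e, ← map_mul, Prod.mk_mul_mk, mul_zero]
    split_ifs with h
    · subst h; simp
    · rw [Matrix.single_mul_single_of_ne _ _ _ _ h]
      exact map_zero _
  have h2 : ∀ n i j, star (e n i j) = e n j i := by
    intro n i j
    simp only [e, ← map_star, Prod.star_def, star_zero]
    simp [Matrix.star_eq_conjTranspose]
  have h3 : ∀ n i j k l, f n i j * f n k l = if j = k then f n i l else 0 := by
    intro n i j k l
    simp only [f, ← map_mul, Prod.mk_mul_mk, mul_zero]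
    split_ifs with h
    · subst h; simp
    · rw [Matrix.single_mul_single_of_ne _ _ _ _ h]
      exact map_zero _
  have h4 : ∀ n i j, star (f n i j) = f n j i := by
    intro n i j
    simp only [f, ← map_star, Prod.star_def, star_zero]
    simp [Matrix.star_eq_conjTranspose]
  have h5 : ∀ n i j k l, e n i j * f n k l = 0 := by
    intro n i j k l
    simp only [e, f, ← map_mul, Prod.mk_mul_mk, mul_zero, zero_mul]
    exact map_zero _
  have h6 : ∀ n i j k l, f n i j * e n k l = 0 := by
    intro n i j k l
    simp only [e, f, ← map_mul, Prod.mk_mul_mk, mul_zero, zero_mul]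
    exact map_zero _
  have h7 : ∀ n, ∑ i, e n i i + ∑ i, f n i i = 1 := by
    intro n
    have hs : ∀ (m : ℕ), ∑ i : Fin m, Matrix.single i i (1 : ℂ) = 1 := by
      intro m
      ext a b
      simp only [Matrix.sum_apply, Matrix.single_apply, Matrix.one_apply]
      by_cases hab : a = b
      · subst hab; simp
      · rw [if_neg hab]
        refine Finset.sum_eq_zero fun i _ => if_neg ?_
        rintro ⟨rfl, rfl⟩; exact hab rfl
    simp only [e, f, ← map_sum, ← map_add]
    rw [← map_one (φ n)]
    congr 1
    ext1
    · simp [Prod.fst_sum, hs]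
    · simp [Prod.snd_sum, hs]
  let o : Fin N := ⟨0, hN⟩
  refine ⟨e, f, fun n c => ∑ i, e n i o * c * e n o i + ∑ i, f n i 0 * c * f n 0 i,
    h1, h2, h3, h4, h5, h6, h7, ?_, ?_, ?_, ?_⟩
  · intro n c i j
    exact (avg_comm (h1 n) o c i j).add_right
      (avg_zero (fun a b k l => h6 n a b k l) (fun a b k l => h5 n k l a b) 0 c i j)
  · intro n c i j
    exact (avg_zero (fun a b k l => h5 n a b k l) (fun a b k l => h6 n k l a b) o c i j).add_right
      (avg_comm (h3 n) 0 c i j)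
  · intro n c
    simp only [star_add, star_sum, star_mul, h2, h4, mul_assoc]
  · intro c
    have t1 := avg_tendsto h1 h2 (fun i j c => hφ _ c) o c
    have t2 := avg_tendsto h3 h4 (fun i j c => hφ _ c) 0 c
    have t3 := (t1.add t2).add_const c
    simp only [add_zero, zero_add] at t3
    refine t3.congr fun n => ?_
    have : (∑ i, e n i i) * c + (∑ i, f n i i) * c = c := by rw [← add_mul, h7, one_mul]
    rw [sub_add_sub_comm, this, sub_add_cancel]

lemma approx_s {E : ℕ → A → A} (hEs : ∀ n c, star (E n c) = E n (star c))
    (hE : ∀ c, Tendsto (fun n => E n c) atTop (𝓝 c)) {p : A} {P : ℕ → A}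
    (hP : Tendsto P atTop (𝓝 p)) (hPp : ∀ᶠ n in atTop, IsStarProjection (P n))
    {K : ℕ} {s : Fin K → A} (hs : ∀ i, (1 - p) * s i = s i) (hs1 : ∑ i, star (s i) * s i = 1) :
    ∃ S : ℕ → Fin K → A, ∀ᶠ n in atTop, (∀ i, P n * S n i = 0) ∧
      ∑ i, star (S n i) * S n i = 1 ∧
      ∀ x, Commute x (P n) → (∀ c, Commute x (E n c)) → ∀ i, Commute x (S n i) := by
  let w : ℕ → Fin K → A := fun n i => (1 - P n) * E n (s i)
  let T : ℕ → A := fun n => ∑ i, star (w n i) * w n i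
  have hTs : ∀ n, IsSelfAdjoint (T n) := fun n =>
    isSelfAdjoint_sum _ fun i _ => IsSelfAdjoint.star_mul_self _
  have hw : ∀ i, Tendsto (fun n => w n i) atTop (𝓝 (s i)) := by
    intro i
    have := (tendsto_const_nhds (x := (1 : A)).sub hP).mul (hE (s i))
    rwa [hs] at this
  have hT : Tendsto T atTop (𝓝 1) := by
    rw [← hs1]
    exact tendsto_finsetSum _ fun i _ => (hw i).star.mul (hw i)
  have hT1 := (tendsto_iff_norm_sub_tendsto_zero.1 hT).eventually_lt_const
      (show (0 : ℝ) < 1 / 2 by norm_num)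
  refine ⟨fun n i => w n i * nrm (T n), ?_⟩
  filter_upwards [hPp, hT1] with n hp hn
  refine ⟨fun i => ?_, ?_, ?_⟩
  · simp only [w, ← mul_assoc, hp.mul_one_sub_self, zero_mul]
  · rw [← nrm_mul (hTs n) hn]
    simp only [T]
    rw [Finset.mul_sum, Finset.sum_mul]
    refine Finset.sum_congr rfl fun i _ => ?_
    rw [star_mul, (nrm_sa _).star_eq]
    noncomm_ring
  · intro x hx hxE i
    have c1 : ∀ i, Commute x (w n i) := fun i =>
      ((Commute.one_right x).sub_right hx).mul_right (hxE _)
    have c2 : ∀ i, Commute x (star (w n i)) := fun i => by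
      simp only [w, star_mul, hp.one_sub.isSelfAdjoint.star_eq, hEs]
      exact (hxE _).mul_right ((Commute.one_right x).sub_right hx)
    have c3 : Commute x (T n) := Commute.sum_right _ _ _ fun i _ => (c2 i).mul_right (c1 i)
    exact (c1 i).mul_right (nrm_comm c3.symm).symm

lemma approx_v {E : ℕ → A → A} (hEs : ∀ n c, star (E n c) = E n (star c))
    (hE : ∀ c, Tendsto (fun n => E n c) atTop (𝓝 c)) {p v : A} {P : ℕ → A}
    (hp : IsStarProjection p)
    (hP : Tendsto P atTop (𝓝 p)) (hPp : ∀ᶠ n in atTop, IsStarProjection (P n))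
    (hPs : ∀ n, IsSelfAdjoint (P n))
    (hv : star v * v = p) :
    ∃ V : ℕ → A, Tendsto V atTop (𝓝 v) ∧ ∀ᶠ n in atTop, star (V n) * V n = P n ∧
      IsStarProjection (V n * star (V n)) ∧
      ∀ x, Commute x (P n) → (∀ c, Commute x (E n c)) → Commute x (V n) ∧
        Commute x (star (V n)) := by
  have hvp : v * p = v := by
    have := star_fix (u := star v) hp (by rwa [star_star])
    have := congrArg star this
    rwa [star_mul, star_star, hp.isSelfAdjoint.star_eq] at this
  let w : ℕ → A := fun n => P n * E n (star v)
  have hw : Tendsto w atTop (𝓝 (star v)) := by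
    have := hP.mul (hE (star v))
    rwa [show p * star v = star v by
      have := congrArg star hvp; rwa [star_mul, hp.isSelfAdjoint.star_eq] at this] at this
  let Y : ℕ → A := fun n => w n * star (w n) + (1 - P n)
  have hYs : ∀ n, IsSelfAdjoint (Y n) := fun n =>
    (IsSelfAdjoint.mul_star_self _).add ((IsSelfAdjoint.one A).sub (hPs n))
  have hY : Tendsto Y atTop (𝓝 1) := by
    have := (hw.mul hw.star).add (tendsto_const_nhds (x := (1 : A)).sub hP)
    rwa [star_star, hv, add_sub_cancel] at this
  have hww : Tendsto (fun n => w n * star (w n) - P n) atTop (𝓝 0) := by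
    have := (hw.mul hw.star).sub hP
    rwa [star_star, hv, sub_self] at this
  have hT1 := (tendsto_zero_iff_norm_tendsto_zero.1 hww).eventually_lt_const
      (show (0 : ℝ) < 1 / 2 by norm_num)
  refine ⟨fun n => star (w n) * nrm (Y n), ?_, ?_⟩
  · have := hw.star.mul (nrm_tendsto hYs hY)
    rwa [star_star, mul_one] at this
  filter_upwards [hPp, hT1] with n hpn hn
  have hpf := polar_fix (w := w n) hpn
    (by simp only [w, ← mul_assoc, hpn.isIdempotentElem.eq]) hn
  have h1 : star (star (w n) * nrm (Y n)) * (star (w n) * nrm (Y n)) = P n := by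
    rw [star_mul, star_star, (nrm_sa _).star_eq]
    refine Eq.trans ?_ hpf
    simp only [Y]
    noncomm_ring
  refine ⟨h1, ?_, ?_⟩
  · set V := star (w n) * nrm (Y n)
    refine ⟨?_, IsSelfAdjoint.mul_star_self _⟩
    have := star_fix (u := star V) hpn (by rwa [star_star])
    show V * star V * (V * star V) = _
    calc _ = V * ((star V * V) * star V) := by noncomm_ring
      _ = _ := by rw [h1, this]
  · intro x hx hxE
    have c1 : Commute x (w n) := hx.mul_right (hxE _)
    have c2 : Commute x (star (w n)) := by
      simp only [w, star_mul, hpn.isSelfAdjoint.star_eq, hEs]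
      exact (hxE _).mul_right hx
    have c3 : Commute x (nrm (Y n)) :=
      (nrm_comm ((c1.mul_right c2).add_right ((Commute.one_right x).sub_right hx)).symm).symm
    refine ⟨c2.mul_right c3, ?_⟩
    rw [star_mul, star_star, (nrm_sa _).star_eq]
    exact c3.mul_right c1

lemma proj_joined (hs : IsSimpleCStarAlgebra A) (hdiv : ApproximatelyDivisible A) {p q v : A}
    (hp : IsStarProjection p) (hq : IsStarProjection q) (hp1 : p ≠ 1) (hq1 : q ≠ 1)
    (hv1 : star v * v = p) (hv2 : v * star v = q) :
    JoinedIn {x : A | IsStarProjection x} p q := by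
  obtain ⟨K₁, s, hs1, hs2⟩ := simple_full hs hp.one_sub (sub_ne_zero.2 hp1.symm)
  obtain ⟨K₂, t, ht1, ht2⟩ := simple_full hs hq.one_sub (sub_ne_zero.2 hq1.symm)
  obtain ⟨e, f, E, he1, he2, hf1, hf2, hef, hfe, hsum, heE, hfE, hEs, hE⟩ :=
    approx_units hdiv (N := K₁ + K₂ + 1) (by omega)
  have hEp : ∀ n, IsSelfAdjoint (E n p) := fun n => by
    show star (E n p) = _
    rw [hEs, hp.isSelfAdjoint.star_eq]
  obtain ⟨hPt, hPp⟩ := chiP_tendsto hp hEp (hE p)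
  set P : ℕ → A := fun n => chiP (E n p) with hPdef
  have hPE : ∀ n x, (∀ c, Commute x (E n c)) → Commute x (P n) := fun n x hx =>
    (chiP_comm (hx p).symm).symm
  obtain ⟨V, hVt, hV⟩ := approx_v hEs hE hp hPt hPp (fun n => cfc_predicate _ _) hv1
  have hQt : Tendsto (fun n => V n * star (V n)) atTop (𝓝 q) := by
    rw [← hv2]; exact hVt.mul hVt.star
  obtain ⟨S, hS⟩ := approx_s hEs hE hPt hPp hs1 hs2
  obtain ⟨T, hT⟩ := approx_s hEs hE hQt (hV.mono fun n h => h.2.1) ht1 ht2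
  have hc1 := (tendsto_iff_norm_sub_tendsto_zero.1 hPt).eventually_lt_const
      (show (0 : ℝ) < 1 / 2 by norm_num)
  have hc2 := (tendsto_iff_norm_sub_tendsto_zero.1 hQt).eventually_lt_const
      (show (0 : ℝ) < 1 / 2 by norm_num)
  obtain ⟨n, hPn, ⟨hV1, hQn, hVc⟩, ⟨hS1, hS2, hS3⟩, ⟨hT1, hT2, hT3⟩, hd1, hd2⟩ :=
    (hPp.and (hV.and (hS.and (hT.and (hc1.and hc2))))).exists
  refine (joined_of_close hp hPn hd1).trans (JoinedIn.trans ?_ (joined_of_close hq hQn hd2).symm)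
  have cV : ∀ x, (∀ c, Commute x (E n c)) → Commute x (V n) := fun x hx =>
    (hVc x (hPE n x hx) hx).1
  have cQ : ∀ x, (∀ c, Commute x (E n c)) → Commute x (V n * star (V n)) := fun x hx =>
    (hVc x (hPE n x hx) hx).1.mul_right (hVc x (hPE n x hx) hx).2
  have cS : ∀ x, (∀ c, Commute x (E n c)) → ∀ i, Commute x (S n i) := fun x hx =>
    hS3 x (hPE n x hx) hx
  have cT : ∀ x, (∀ c, Commute x (E n c)) → ∀ i, Commute x (T n i) := fun x hx =>
    hT3 x (cQ x hx) hx
  have xe : ∀ i j c, Commute (e n i j) (E n c) := fun i j c => heE n c i j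
  have xf : ∀ i j c, Commute (f n i j) (E n c) := fun i j c => hfE n c i j
  have R1 : IsStarProjection (P n * ∑ k, f n k k) := by
    rw [Finset.mul_sum]
    exact diag_proj (g := fun _ => P n) (hf1 n) (hf2 n) (fun _ => hPn)
      (fun _ i j => hPE n _ (xf i j)) _
  have R2 : IsStarProjection (V n * star (V n) * ∑ k, e n k k) := by
    rw [Finset.mul_sum]
    exact diag_proj (g := fun _ => V n * star (V n)) (he1 n) (he2 n) (fun _ => hQn)
      (fun _ i j => cQ _ (xe i j)) _
  have hle1 : K₁ + K₂ ≤ K₁ + K₂ + 1 := by omega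
  have hle2 : K₁ + K₂ ≤ K₁ + K₂ + 1 + 1 := by omega
  have b1 := block_joined (he1 n) (he2 n) hPn hQn (fun i j => hPE n _ (xe i j))
    (fun i j => cQ _ (xe i j)) (fun i j => cV _ (xe i j)) hV1 rfl R1
    (fun i j => by rw [mul_assoc, Finset.sum_mul]; simp [hfe]) hS1 hS2
    (fun k i j => cS _ (xe i j) k) hT1 hT2 (fun k i j => cT _ (xe i j) k)
    (fun x => Fin.castLE hle1 (finSumFinEquiv x))
    ((Fin.castLE_injective hle1).comp finSumFinEquiv.injective)
  have b2 := block_joined (hf1 n) (hf2 n) hPn hQn (fun i j => hPE n _ (xf i j))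
    (fun i j => cQ _ (xf i j)) (fun i j => cV _ (xf i j)) hV1 rfl R2
    (fun i j => by rw [mul_assoc, Finset.sum_mul]; simp [hef]) hS1 hS2
    (fun k i j => cS _ (xf i j) k) hT1 hT2 (fun k i j => cT _ (xf i j) k)
    (fun x => Fin.castLE hle2 (finSumFinEquiv x))
    ((Fin.castLE_injective hle2).comp finSumFinEquiv.injective)
  rw [← mul_add, hsum, mul_one] at b1
  rw [← mul_add, add_comm (∑ k, f n k k), hsum, mul_one, add_comm] at b2
  exact b1.trans b2

end Approx

lemma support_joined [PartialOrder A] [StarOrderedRing A] {a : A} (ha : 0 ≤ a)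
    (hsa : ¬ AccPt (0 : ℝ) (𝓟 (spectrum ℝ a))) :
    ∃ p : A, IsStarProjection p ∧ JoinedIn {x : A | 0 ≤ x ∧ CuntzEquiv x a} a p := by
  have has : IsSelfAdjoint a := IsSelfAdjoint.of_nonneg ha
  obtain ⟨δ, hδ, hsp⟩ : ∃ δ > 0, ∀ x ∈ spectrum ℝ a, x = 0 ∨ δ ≤ x := by
    rw [accPt_iff_nhds] at hsa
    push Not at hsa
    obtain ⟨U, hU, h⟩ := hsa
    obtain ⟨δ, hδ, hb⟩ := Metric.mem_nhds_iff.1 hU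
    refine ⟨δ, hδ, fun x hx => ?_⟩
    have hx0 : 0 ≤ x := spectrum_nonneg_of_nonneg ha hx
    by_contra! hcon
    exact hcon.1 (h x ⟨hb (by simp [abs_of_nonneg hx0, hcon.2]), hx⟩)
  have hm : ∀ x : ℝ, 0 < max x δ := fun x => lt_max_of_lt_right hδ
  have hm0 : ∀ x : ℝ, max x δ ≠ 0 := fun x => (hm x).ne'
  have hfc : Continuous fun x : ℝ => x * (max x δ)⁻¹ :=
    continuous_id.mul (Continuous.inv₀ (by fun_prop) hm0)
  let p : A := cfc (fun x : ℝ => x * (max x δ)⁻¹) a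
  have hp : IsStarProjection p := by
    refine ⟨?_, cfc_predicate _ _⟩
    show p * p = p
    simp only [p]
    rw [← cfc_mul _ _ a hfc.continuousOn hfc.continuousOn]
    refine cfc_congr fun x hx => ?_
    rcases hsp x hx with h | h
    · simp [h]
    · have : max x δ = x := max_eq_left h
      have hx : x ≠ 0 := by linarith
      simp [this, hx]
  refine ⟨p, hp, JoinedIn.ofLine (f := fun t => (1 - t) • a + t • p) (by fun_prop) (by simp)
    (by simp) ?_⟩
  rintro _ ⟨t, ht, rfl⟩
  have ht0 : 0 ≤ t := ht.1
  have ht1 : 0 ≤ 1 - t := by linarith [ht.2]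
  refine ⟨add_nonneg (smul_nonneg ht1 ha) (smul_nonneg ht0 hp.nonneg), ?_⟩
  have hkpos : ∀ x : ℝ, 0 < (1 - t) + t * (max x δ)⁻¹ := by
    intro x
    have := inv_pos.2 (hm x)
    rcases ht0.eq_or_lt with h | h
    · subst h; simp
    · have := mul_pos h this
      linarith
  let k : ℝ → ℝ := fun x => Real.sqrt ((1 - t) + t * (max x δ)⁻¹)
  have hk0 : ∀ x, k x ≠ 0 := fun x => (Real.sqrt_pos.2 (hkpos x)).ne'
  have hkk : ∀ x, k x * k x = (1 - t) + t * (max x δ)⁻¹ := fun x =>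
    Real.mul_self_sqrt (hkpos x).le
  have hkc : Continuous k := by
    refine Real.continuous_sqrt.comp (continuous_const.add (continuous_const.mul ?_))
    exact Continuous.inv₀ (by fun_prop) hm0
  have hkic : Continuous fun x => (k x)⁻¹ := hkc.inv₀ hk0
  have hh : (1 - t) • a + t • p = cfc k a * a * cfc k a := by
    have e1 : (1 - t) • a = cfc (fun x : ℝ => (1 - t) * x) a := by
      rw [cfc_const_mul (1 - t) (fun x : ℝ => x) a (by fun_prop), cfc_id' ℝ a]
    have e2 : t • p = cfc (fun x : ℝ => t * (x * (max x δ)⁻¹)) a :=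
      (cfc_const_mul t _ a hfc.continuousOn).symm
    have e3 : cfc k a * a * cfc k a = cfc (fun x : ℝ => k x * x * k x) a := by
      rw [cfc_mul (fun x => k x * x) k a (hkc.mul continuous_id).continuousOn hkc.continuousOn,
        cfc_mul k (fun x => x) a hkc.continuousOn (by fun_prop), cfc_id' ℝ a]
    rw [e1, e2, e3, ← cfc_add a (fun x : ℝ => (1 - t) * x) (fun x : ℝ => t * (x * (max x δ)⁻¹))
      (by fun_prop) (continuous_const.mul hfc).continuousOn]
    congr 1
    ext x
    linear_combination -x * hkk x
  have hinv : cfc (fun x => (k x)⁻¹) a * cfc k a = 1 := by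
    rw [← cfc_mul _ _ a hkic.continuousOn hkc.continuousOn, ← cfc_one ℝ a]
    refine cfc_congr fun x _ => ?_
    simp [hk0]
  have hinv' : cfc k a * cfc (fun x => (k x)⁻¹) a = 1 := by
    rw [← cfc_mul _ _ a hkc.continuousOn hkic.continuousOn, ← cfc_one ℝ a]
    refine cfc_congr fun x _ => ?_
    simp [hk0]
  have s1 : star (cfc k a) = cfc k a := (cfc_predicate k a : IsSelfAdjoint _).star_eq
  have s2 : star (cfc (fun x => (k x)⁻¹) a) = cfc (fun x => (k x)⁻¹) a :=
    (cfc_predicate (fun x => (k x)⁻¹) a : IsSelfAdjoint _).star_eq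
  refine ⟨cuntzLE_of_eq (v := cfc k a) (by rw [s1]; exact hh.symm),
    cuntzLE_of_eq (v := cfc (fun x => (k x)⁻¹) a) ?_⟩
  rw [s2]
  show cfc (fun x => (k x)⁻¹) a * ((1 - t) • a + t • p) * cfc (fun x => (k x)⁻¹) a = a
  rw [hh]
  calc _ = (cfc (fun x => (k x)⁻¹) a * cfc k a) * a * (cfc k a * cfc (fun x => (k x)⁻¹) a) := by
        noncomm_ring
    _ = a := by rw [hinv, hinv']; simp

end Helpers


/-- The compact-Cuntz-class case of Theorem 1.1: in a unital simple
separable approximately divisible stably finite C*-algebra, two Cuntz equivalent nonzero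
positive elements whose spectra do not accumulate at `0` are joined by a norm-continuous
path of positive elements of constant Cuntz class. -/
theorem homotopy_of_isolated_zero_spectra {A : Type*} [CStarAlgebra A] [PartialOrder A]
    [StarOrderedRing A] [TopologicalSpace.SeparableSpace A]
    (hsimple : IsSimpleCStarAlgebra A)
    (hdiv : ApproximatelyDivisible A)
    (hsf : StablyFinite A)
    (a b : A) (ha : 0 ≤ a) (hb : 0 ≤ b) (ha0 : a ≠ 0) (hb0 : b ≠ 0)
    (hsa : ¬ AccPt (0 : ℝ) (𝓟 (spectrum ℝ a)))
    (hsb : ¬ AccPt (0 : ℝ) (𝓟 (spectrum ℝ b)))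
    (heq : CuntzEquiv a b) :
    ∃ h : ℝ → A, ContinuousOn h (Set.Icc 0 1) ∧ h 0 = a ∧ h 1 = b ∧
      ∀ t ∈ Set.Icc (0 : ℝ) 1, 0 ≤ h t ∧ CuntzEquiv (h t) a := by
  obtain ⟨p, hp, hap⟩ := support_joined ha hsa
  obtain ⟨q, hq, hbq⟩ := support_joined hb hsb
  have hpa : CuntzEquiv p a := hap.target_mem.2
  have hqb : CuntzEquiv q b := hbq.target_mem.2
  have hpq : CuntzEquiv p q := cuntz_trans hpa (cuntz_trans heq (cuntz_symm hqb))
  obtain ⟨v, hv1, hv2⟩ := mvn_of_cuntz hsf hp hq hpq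
  have hproj : JoinedIn {x : A | IsStarProjection x} p q := by
    by_cases hp1 : p = 1
    · have : q = p := by rw [← hv2, hp1]; exact finite_of_sf hsf (by rw [hv1, hp1])
      rw [this]; exact JoinedIn.refl hp
    by_cases hq1 : q = 1
    · have : p = q := by
        have := finite_of_sf hsf (v := star v) (by rw [star_star, hv2, hq1])
        rw [star_star, hv1] at this
        rw [this, hq1]
      rw [this]; exact JoinedIn.refl hq
    exact proj_joined hsimple hdiv hp hq hp1 hq1 hv1 hv2
  have h2 : JoinedIn {x : A | 0 ≤ x ∧ CuntzEquiv x a} p q :=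
    (joined_cuntz hproj).mono fun x hx => ⟨hx.1.nonneg, cuntz_trans hx.2 hpa⟩
  have h3 : JoinedIn {x : A | 0 ≤ x ∧ CuntzEquiv x a} q b :=
    hbq.symm.mono fun x hx => ⟨hx.1, cuntz_trans hx.2 (cuntz_symm heq)⟩
  obtain ⟨γ, hγ⟩ := hap.trans (h2.trans h3)
  refine ⟨γ.extend, γ.continuous_extend.continuousOn, γ.extend_zero, γ.extend_one, ?_⟩
  intro t ht
  rw [γ.extend_apply ht]
  exact hγ ⟨t, ht⟩
end
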